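/- arXiv:2508.02019 — 3 statements merged into one kernel-verified Lean document; each statement's English description precedes it below -/
import Mathlib

section
/- Let (H, α, β, ·, Δ, ε) be a Hopf algebroid over R and suppose F = F₁⊗_R F₂ ∈ H⊗_R H satisfies (T1) (Δ⊗_R id)(F)·(F⊗_R 1) = (id⊗_R Δ)(F)·(1⊗_R F) and (T2) (ε⊗_R id)F = (id⊗_R ε)F = 1. Define α_F(a) := α(F₁▷a)·F₂ and β_F(a) := β(F₂▷a)·F₁ for a ∈ R. Then α_F : R_F → H is an algebra homomorphism and β_F : R_F → H is an algebra anti-homomorphism (with respect to the product ⋆_F on R_F := (R, ⋆_F)), their images commute (α_F(a)·β_F(b) = β_F(b)·α_F(a) for all a, b ∈ R), and F·(β_F(a)⊗1 − 1⊗α_F(a)) = 0 in H⊗_R H for all a ∈ R. -/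
/-! # Preliminaries: Hopf algebroids in the sense of Xu

We fix a field `K` of characteristic zero, an associative unital `K`-algebra `R` and an
associative unital `K`-algebra `H`.  We construct the `n`-fold tensor powers
`H^{⊗_K n}` of `H` over `K` and, given source and target maps `α, β : R → H`, the
quotients `H^{⊗_R n}` of `H^{⊗_K n}` by the right ideal `I_n` generated by the elements
`1 ⊗ ⋯ ⊗ β(r) ⊗ 1 ⊗ ⋯ ⊗ 1 − 1 ⊗ ⋯ ⊗ 1 ⊗ α(r) ⊗ ⋯ ⊗ 1`.

A Hopf algebroid is then given by the data `(H, α, β, ·, Δ, ε)` subject to the axioms of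
Xu; the iterated coproducts `Δⁿ = (Δ^{n−1} ⊗_R id) ∘ Δ` are part of the data, uniquely
characterized by their recursion.  All axioms involving maps induced on the quotients
`H^{⊗_R n}` are stated equivalently in terms of (arbitrary) lifts along the quotient
maps and (arbitrary) presentations of elements as sums of pure tensors. -/

noncomputable section

open scoped TensorProduct

universe u

variable (K : Type u) [Field K] [CharZero K]

/-- A bundled associative unital `K`-algebra. -/
structure BAlg : Type (u + 1) where
  carrier : Type u
  [isRing : Ring carrier]
  [isAlgebra : Algebra K carrier]

attribute [instance] BAlg.isRing BAlg.isAlgebra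

instance : CoeSort (BAlg K) (Type u) := ⟨BAlg.carrier⟩

variable (H : Type u) [Ring H] [Algebra K H]

/-- The `n`-fold tensor power `H^{⊗_K n}` of `H` over `K` (with `H^{⊗_K 0} = K` and
`H^{⊗_K 1} = H`), as a bundled `K`-algebra. -/
def TPa : ℕ → BAlg K
  | 0 => ⟨K⟩
  | 1 => ⟨H⟩
  | (n + 2) => ⟨(TPa (n + 1)) ⊗[K] H⟩

/-- The `n`-fold tensor power `H^{⊗_K n}`. -/
abbrev TP (n : ℕ) : Type u := TPa K H n

/-- The element of `H^{⊗_K n}` with `h` in slot `i` (`0`-indexed) and `1` in all other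
slots. -/
def slotP : (n : ℕ) → ℕ → H → TP K H n
  | 0, _, _ => 1
  | 1, _, h => h
  | (n + 2), i, h =>
      if i = n + 1 then ((1 : TP K H (n + 1)) ⊗ₜ[K] h : TP K H (n + 1) ⊗[K] H)
      else ((slotP (n + 1) i h) ⊗ₜ[K] (1 : H) : TP K H (n + 1) ⊗[K] H)

/-- The pure tensor `x₀ ⊗ x₁ ⊗ ⋯ ⊗ x_{n-1} ∈ H^{⊗_K n}`, written as the product of its
slot components. -/
def chainP (n : ℕ) (x : Fin n → H) : TP K H n :=
  (List.ofFn (fun i : Fin n => slotP K H n (i : ℕ) (x i))).prod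

variable {R : Type u} [Ring R] [Algebra K R]

/-- The relator `1 ⊗ ⋯ ⊗ β(r) ⊗ 1 ⊗ ⋯ ⊗ 1 − 1 ⊗ ⋯ ⊗ 1 ⊗ α(r) ⊗ ⋯ ⊗ 1` with `β(r)` in
slot `i` and `α(r)` in slot `i + 1` (`0`-indexed). -/
def relator (αf βf : R → H) (n : ℕ) (r : R) (i : ℕ) : TP K H n :=
  slotP K H n i (βf r) - slotP K H n (i + 1) (αf r)

/-- The right ideal `I_n ⊆ H^{⊗_K n}` generated by the relators. -/
def Idl (αf βf : R → H) (n : ℕ) : Submodule K (TP K H n) :=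
  Submodule.span K
    {z | ∃ (r : R) (i : ℕ) (x : TP K H n), i + 2 ≤ n ∧ z = relator K H αf βf n r i * x}

/-- The `n`-fold tensor power `H^{⊗_R n} := H^{⊗_K n} / I_n` of `H` over `R`
(`H^{⊗_R 1} = H` and, by convention, `H^{⊗_R 0} = R` is treated separately). -/
abbrev QT (αf βf : R → H) (n : ℕ) : Type u := TP K H n ⧸ Idl K H αf βf n

/-- The quotient map `H^{⊗_K n} → H^{⊗_R n}`. -/
abbrev qtMk (αf βf : R → H) (n : ℕ) : TP K H n →ₗ[K] QT K H αf βf n :=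
  (Idl K H αf βf n).mkQ

variable (R)

/-- A Hopf algebroid `(H, α, β, ·, Δ, ε)` over `R`, in the sense of Xu, together with its
(uniquely characterized) iterated coproducts `Δⁿ`.  The source map `α` (an algebra
homomorphism) and the target map `β` (an algebra anti-homomorphism) are taken as
parameters.  All conditions on elements of the quotients `H^{⊗_R n}` are expressed via
arbitrary lifts along the quotient maps. -/
structure HopfAlgebroid (α : R →ₐ[K] H) (β : R →ₗ[K] H) : Type u where
  β_one : β 1 = 1
  /-- `β` is an algebra anti-homomorphism -/
  β_mul : ∀ a b : R, β (a * b) = β b * β a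
  /-- the images of `α` and `β` commute -/
  αβ_comm : ∀ a b : R, α a * β b = β b * α a
  /-- the coproduct -/
  Δ : H →ₗ[K] QT K H (fun a => α a) (fun a => β a) 2
  Δ_one : Δ 1 = qtMk K H (fun a => α a) (fun a => β a) 2 1
  /-- `Δ(x) · (β(a) ⊗ 1 − 1 ⊗ α(a)) = 0` -/
  Δ_compat : ∀ (x : H) (a : R) (s : TP K H 2),
    qtMk K H (fun a => α a) (fun a => β a) 2 s = Δ x →
    qtMk K H (fun a => α a) (fun a => β a) 2
      (s * relator K H (fun a => α a) (fun a => β a) 2 a 0) = 0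
  /-- `Δ(x₁ x₂) = Δ(x₁) · Δ(x₂)` -/
  Δ_mul : ∀ (x y : H) (s t : TP K H 2),
    qtMk K H (fun a => α a) (fun a => β a) 2 s = Δ x →
    qtMk K H (fun a => α a) (fun a => β a) 2 t = Δ y →
    Δ (x * y) = qtMk K H (fun a => α a) (fun a => β a) 2 (s * t)
  /-- `Δ` is a morphism of `(R,R)`-bimodules, left action -/
  Δ_bimod_left : ∀ (a : R) (x : H) (s : TP K H 2),
    qtMk K H (fun a => α a) (fun a => β a) 2 s = Δ x →
    Δ (α a * x) = qtMk K H (fun a => α a) (fun a => β a) 2 (slotP K H 2 0 (α a) * s)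
  /-- `Δ` is a morphism of `(R,R)`-bimodules, right action -/
  Δ_bimod_right : ∀ (a : R) (x : H) (s : TP K H 2),
    qtMk K H (fun a => α a) (fun a => β a) 2 s = Δ x →
    Δ (β a * x) = qtMk K H (fun a => α a) (fun a => β a) 2 (slotP K H 2 1 (β a) * s)
  /-- coassociativity `(Δ ⊗_R id) ∘ Δ = (id ⊗_R Δ) ∘ Δ` -/
  coassoc : ∀ (x : H) (C : ℕ) (uu vv : Fin C → H),
    qtMk K H (fun a => α a) (fun a => β a) 2 (∑ c, (uu c ⊗ₜ[K] vv c : TP K H 2)) = Δ x →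
    ∀ s t : Fin C → TP K H 2,
      (∀ c, qtMk K H (fun a => α a) (fun a => β a) 2 (s c) = Δ (uu c)) →
      (∀ c, qtMk K H (fun a => α a) (fun a => β a) 2 (t c) = Δ (vv c)) →
      qtMk K H (fun a => α a) (fun a => β a) 3 (∑ c, (s c ⊗ₜ[K] vv c : TP K H 3)) =
        qtMk K H (fun a => α a) (fun a => β a) 3
          (∑ c, (TensorProduct.assoc K H H H).symm (uu c ⊗ₜ[K] t c))
  /-- the counit -/
  ε : H →ₗ[K] R
  ε_one : ε 1 = 1
  ε_bimod_left : ∀ (a : R) (x : H), ε (α a * x) = a * ε x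
  ε_bimod_right : ∀ (a : R) (x : H), ε (β a * x) = ε x * a
  /-- `(ε ⊗_R id) ∘ Δ = id` -/
  counit_left : ∀ (x : H) (C : ℕ) (uu vv : Fin C → H),
    qtMk K H (fun a => α a) (fun a => β a) 2 (∑ c, (uu c ⊗ₜ[K] vv c : TP K H 2)) = Δ x →
    ∑ c, α (ε (uu c)) * vv c = x
  /-- `(id ⊗_R ε) ∘ Δ = id` -/
  counit_right : ∀ (x : H) (C : ℕ) (uu vv : Fin C → H),
    qtMk K H (fun a => α a) (fun a => β a) 2 (∑ c, (uu c ⊗ₜ[K] vv c : TP K H 2)) = Δ x →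
    ∑ c, β (ε (vv c)) * uu c = x
  /-- `ker ε` is a left ideal of `H` -/
  ker_ε_ideal : ∀ x y : H, ε y = 0 → ε (x * y) = 0
  /-- the iterated coproducts `Δⁿ : H → H^{⊗_R (n+1)}` -/
  Δpow : ∀ n : ℕ, H →ₗ[K] QT K H (fun a => α a) (fun a => β a) (n + 1)
  Δpow_zero : ∀ x : H, Δpow 0 x = qtMk K H (fun a => α a) (fun a => β a) 1 x
  Δpow_one : Δpow 1 = Δ
  /-- `Δ^{n+1} = (Δⁿ ⊗_R id) ∘ Δ` -/
  Δpow_succ : ∀ (n : ℕ) (x : H) (C : ℕ) (uu vv : Fin C → H),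
    qtMk K H (fun a => α a) (fun a => β a) 2 (∑ c, (uu c ⊗ₜ[K] vv c : TP K H 2)) = Δ x →
    ∀ s : Fin C → TP K H (n + 1),
      (∀ c, qtMk K H (fun a => α a) (fun a => β a) (n + 1) (s c) = Δpow n (uu c)) →
      Δpow (n + 1) x =
        qtMk K H (fun a => α a) (fun a => β a) (n + 2)
          (∑ c, (s c ⊗ₜ[K] vv c : TP K H (n + 2)))

namespace HopfAlgebroid

variable {K H R}
variable {α : R →ₐ[K] H} {β : R →ₗ[K] H} (D : HopfAlgebroid K H R α β)

/-- The left `H`-module structure `h ▷ a := ε(h · α(a))` on `R`. -/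
def hAct (h : H) (a : R) : R := D.ε (h * α a)

end HopfAlgebroid
/-! ### Twistor-type elements: common definitions -/

section TwistorBasics

variable {K : Type u} [Field K] [CharZero K]
variable {H : Type u} [Ring H] [Algebra K H]
variable {R : Type u} [Ring R] [Algebra K R]
variable {α : R →ₐ[K] H} {β : R →ₗ[K] H}

/-- Given a presentation `F = Σ_c (p c) ⊗_R (q c)` of an element of `H ⊗_R H`, the
induced product `a ⋆_F b := (F₁ ▷ a) · (F₂ ▷ b)` on `R`. -/
def starF (D : HopfAlgebroid K H R α β) {C : ℕ} (p q : Fin C → H) (a b : R) : R :=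
  ∑ c, D.hAct (p c) a * D.hAct (q c) b

/-- The twisted source map `α_F(a) := α(F₁ ▷ a) · F₂`. -/
def alphaF (D : HopfAlgebroid K H R α β) {C : ℕ} (p q : Fin C → H) (a : R) : H :=
  ∑ c, α (D.hAct (p c) a) * q c

/-- The twisted target map `β_F(a) := β(F₂ ▷ a) · F₁`. -/
def betaF (D : HopfAlgebroid K H R α β) {C : ℕ} (p q : Fin C → H) (a : R) : H :=
  ∑ c, β (D.hAct (q c) a) * p c

/-- The twistor equation (T1):
`(Δ ⊗_R id)(F) · (F ⊗_R 1) = (id ⊗_R Δ)(F) · (1 ⊗_R F)` in `H^{⊗_R 3}`, expressed via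
a presentation `F = Σ_c (p c) ⊗_R (q c)` and lifts `s c`, `t c` of `Δ(p c)`, `Δ(q c)`. -/
def TwistorEq1 (D : HopfAlgebroid K H R α β) {C : ℕ} (p q : Fin C → H)
    (s t : Fin C → TP K H 2) : Prop :=
  qtMk K H (fun a => α a) (fun a => β a) 3
      ((∑ c, (s c ⊗ₜ[K] q c : TP K H 3)) *
        (∑ c, ((p c ⊗ₜ[K] q c : TP K H 2) ⊗ₜ[K] (1 : H) : TP K H 3))) =
    qtMk K H (fun a => α a) (fun a => β a) 3
      ((∑ c, (TensorProduct.assoc K H H H).symm (p c ⊗ₜ[K] t c)) *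
        (∑ c, (TensorProduct.assoc K H H H).symm ((1 : H) ⊗ₜ[K] (p c ⊗ₜ[K] q c : TP K H 2))))

/-- The counit condition (T2): `(ε ⊗_R id)F = (id ⊗_R ε)F = 1`. -/
def TwistorEq2 (D : HopfAlgebroid K H R α β) {C : ℕ} (p q : Fin C → H) : Prop :=
  (∑ c, α (D.ε (p c)) * q c = 1) ∧ (∑ c, β (D.ε (q c)) * p c = 1)

end TwistorBasics
/-! ### Helper lemmas -/

section Helpers

variable {K : Type u} [Field K] [CharZero K]
variable {H : Type u} [Ring H] [Algebra K H]
variable {R : Type u} [Ring R] [Algebra K R]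
variable {α : R →ₐ[K] H} {β : R →ₗ[K] H}

/-- balanced maps out of `H ⊗ H` factor through the quotient -/
theorem hlp_fac2 {M : Type u} [AddCommGroup M] [Module K M]
    (f : H ⊗[K] H →ₗ[K] M)
    (h1 : ∀ r x y, f ((β r * x) ⊗ₜ y) = f (x ⊗ₜ (α r * y)))
    (u v : TP K H 2)
    (h : qtMk K H (fun a => α a) (fun a => β a) 2 u
      = qtMk K H (fun a => α a) (fun a => β a) 2 v) : f u = f v := by
  let g : TP K H 2 →ₗ[K] M := f
  have key : Idl K H (fun a => α a) (fun a => β a) 2 ≤ LinearMap.ker g := by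
    refine Submodule.span_le.2 ?_
    rintro z ⟨r, i, x, hi, rfl⟩
    obtain rfl : i = 0 := by omega
    suffices hx : ∀ x : H ⊗[K] H,
        f ((((β r) ⊗ₜ[K] (1 : H)) - ((1 : H) ⊗ₜ[K] (α r)) : H ⊗[K] H) * x) = 0 from hx x
    clear x
    intro x
    induction x using TensorProduct.induction_on with
    | zero => rw [mul_zero, map_zero]
    | tmul x y =>
      rw [sub_mul, Algebra.TensorProduct.tmul_mul_tmul, Algebra.TensorProduct.tmul_mul_tmul,
        one_mul, one_mul, map_sub, h1, sub_self]
    | add x y hx hy => rw [mul_add, map_add, hx, hy, add_zero]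
  have := key ((Submodule.Quotient.eq _).1 h)
  exact sub_eq_zero.1 ((map_sub g u v).symm.trans this)

/-- balanced maps out of `H ⊗ H ⊗ H` factor through the quotient -/
theorem hlp_fac3 {M : Type u} [AddCommGroup M] [Module K M]
    (f : (H ⊗[K] H) ⊗[K] H →ₗ[K] M)
    (h1 : ∀ r x y z, f (((β r * x) ⊗ₜ y) ⊗ₜ z) = f ((x ⊗ₜ (α r * y)) ⊗ₜ z))
    (h2 : ∀ r x y z, f ((x ⊗ₜ (β r * y)) ⊗ₜ z) = f ((x ⊗ₜ y) ⊗ₜ (α r * z)))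
    (u v : TP K H 3)
    (h : qtMk K H (fun a => α a) (fun a => β a) 3 u
      = qtMk K H (fun a => α a) (fun a => β a) 3 v) : f u = f v := by
  let g : TP K H 3 →ₗ[K] M := f
  have key : Idl K H (fun a => α a) (fun a => β a) 3 ≤ LinearMap.ker g := by
    refine Submodule.span_le.2 ?_
    rintro z ⟨r, i, x, hi, rfl⟩
    have ind : ∀ w : (H ⊗[K] H) ⊗[K] H,
        (∀ x y z : H, f (w * ((x ⊗ₜ y) ⊗ₜ z)) = 0) → ∀ x, f (w * x) = 0 := by
      intro w hw x
      induction x using TensorProduct.induction_on with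
      | zero => rw [mul_zero, map_zero]
      | tmul x z =>
        induction x using TensorProduct.induction_on with
        | zero => rw [TensorProduct.zero_tmul, mul_zero, map_zero]
        | tmul x y => exact hw x y z
        | add x y hx hy => rw [TensorProduct.add_tmul, mul_add, map_add, hx, hy, add_zero]
      | add x y hx hy => rw [mul_add, map_add, hx, hy, add_zero]
    obtain rfl | rfl : i = 0 ∨ i = 1 := by omega
    · refine ind ((((β r) ⊗ₜ[K] (1 : H)) ⊗ₜ[K] (1 : H)) -
        (((1 : H) ⊗ₜ[K] (α r)) ⊗ₜ[K] (1 : H))) (fun x y z => ?_) x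
      rw [sub_mul]
      simp only [Algebra.TensorProduct.tmul_mul_tmul, one_mul]
      rw [map_sub, h1, sub_self]
    · refine ind ((((1 : H) ⊗ₜ[K] (β r)) ⊗ₜ[K] (1 : H)) -
        ((1 : H ⊗[K] H) ⊗ₜ[K] (α r))) (fun x y z => ?_) x
      rw [sub_mul]
      simp only [Algebra.TensorProduct.tmul_mul_tmul, one_mul]
      rw [map_sub, h2, sub_self]
  have := key ((Submodule.Quotient.eq _).1 h)
  exact sub_eq_zero.1 ((map_sub g u v).symm.trans this)

variable (D : HopfAlgebroid K H R α β)

/-- the action as a linear map in the algebra element -/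
def hlpAct (a : R) : H →ₗ[K] R := D.ε ∘ₗ LinearMap.mulRight K (α a)

theorem hlpAct_apply (a : R) (h : H) : hlpAct D a h = D.ε (h * α a) := rfl

theorem hlp_ε_mul (x y : H) : D.ε (x * y) = D.ε (x * α (D.ε y)) := by
  have h0 : D.ε (α (D.ε y)) = D.ε y := by
    have := D.ε_bimod_left (D.ε y) 1
    rwa [mul_one, D.ε_one, mul_one] at this
  have := D.ker_ε_ideal x (y - α (D.ε y)) (by rw [map_sub, h0, sub_self])
  rw [mul_sub, map_sub] at this
  exact sub_eq_zero.1 this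

theorem hlp_ε_β (x : H) (a : R) : D.ε (x * β a) = D.ε (x * α a) := by
  have h0 : D.ε (β a) = a := by
    have := D.ε_bimod_right a 1
    rwa [mul_one, D.ε_one, one_mul] at this
  rw [hlp_ε_mul, h0]

theorem hlpAct_mul (a : R) (x y : H) : hlpAct D a (x * y) = hlpAct D (hlpAct D a y) x := by
  rw [hlpAct_apply, hlpAct_apply, hlpAct_apply, mul_assoc, hlp_ε_mul]

theorem hlpAct_α (a r : R) (x : H) : hlpAct D a (α r * x) = r * hlpAct D a x := by
  rw [hlpAct_apply, mul_assoc, D.ε_bimod_left]; rfl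

theorem hlpAct_β (a r : R) (x : H) : hlpAct D a (β r * x) = hlpAct D a x * r := by
  rw [hlpAct_apply, mul_assoc, D.ε_bimod_right]; rfl

/-- `x ⊗ y ↦ α(x ▷ a) y` -/
def hlpA (a : R) : H ⊗[K] H →ₗ[K] H :=
  TensorProduct.lift ((LinearMap.mul K H).compl₁₂ (α.toLinearMap ∘ₗ hlpAct D a) LinearMap.id)

/-- `x ⊗ y ↦ β(y ▷ a) x` -/
def hlpB (a : R) : H ⊗[K] H →ₗ[K] H :=
  TensorProduct.lift ((LinearMap.mul K H).flip.compl₁₂ LinearMap.id (β ∘ₗ hlpAct D a))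

/-- `x ⊗ y ↦ (x ▷ a) (y ▷ b)` -/
def hlpM (a b : R) : H ⊗[K] H →ₗ[K] R :=
  TensorProduct.lift ((LinearMap.mul K R).compl₁₂ (hlpAct D a) (hlpAct D b))

theorem hlpA_tmul (a : R) (x y : H) : hlpA D a (x ⊗ₜ y) = α (hlpAct D a x) * y := rfl

theorem hlpB_tmul (a : R) (x y : H) : hlpB D a (x ⊗ₜ y) = β (hlpAct D a y) * x := rfl

theorem hlpM_tmul (a b : R) (x y : H) :
    hlpM D a b (x ⊗ₜ y) = hlpAct D a x * hlpAct D b y := rfl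

theorem hlp_fin (S : H ⊗[K] H) : ∃ (n : ℕ) (u v : Fin n → H), S = ∑ c, u c ⊗ₜ[K] v c := by
  obtain ⟨T, rfl⟩ := TensorProduct.exists_finset S
  refine ⟨T.card, fun c => (T.equivFin.symm c).1.1, fun c => (T.equivFin.symm c).1.2, ?_⟩
  rw [Equiv.sum_comp T.equivFin.symm (fun i : T => i.1.1 ⊗ₜ[K] i.1.2)]
  exact (Finset.sum_coe_sort T (fun i => i.1 ⊗ₜ[K] i.2)).symm

theorem hlp_counit_left (h : H) (S : H ⊗[K] H)
    (hS : qtMk K H (fun a => α a) (fun a => β a) 2 S = D.Δ h) : hlpA D 1 S = h := by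
  obtain ⟨n, u, v, rfl⟩ := hlp_fin S
  rw [map_sum]
  simp only [hlpA_tmul, hlpAct_apply, map_one, mul_one]
  exact D.counit_left h n u v hS

theorem hlp_counit_right (h : H) (S : H ⊗[K] H)
    (hS : qtMk K H (fun a => α a) (fun a => β a) 2 S = D.Δ h) : hlpB D 1 S = h := by
  obtain ⟨n, u, v, rfl⟩ := hlp_fin S
  rw [map_sum]
  simp only [hlpB_tmul, hlpAct_apply, map_one, mul_one]
  exact D.counit_right h n u v hS

theorem hlpA_lift (a : R) (h : H) (S : H ⊗[K] H)
    (hS : qtMk K H (fun a => α a) (fun a => β a) 2 S = D.Δ h) : hlpA D a S = h * α a := by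
  have h1 := D.Δ_bimod_left a 1 1 D.Δ_one.symm
  have h2 := D.Δ_mul h (α a * 1) S _ hS h1.symm
  have h3 : hlpA D 1 (S * (((α a) ⊗ₜ[K] (1 : H)) * (1 : H ⊗[K] H))) = h * (α a * 1) :=
    hlp_counit_left D _ _ h2.symm
  rw [mul_one, mul_one] at h3
  rw [← h3]
  clear hS h2 h3
  induction S using TensorProduct.induction_on with
  | zero => rw [zero_mul, map_zero, map_zero]
  | tmul x y =>
    rw [Algebra.TensorProduct.tmul_mul_tmul, hlpA_tmul, hlpA_tmul, hlpAct_apply, hlpAct_apply,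
      map_one, mul_one, mul_one]
  | add x y hx hy => rw [add_mul, map_add, map_add, hx, hy]

theorem hlpB_lift (a : R) (h : H) (S : H ⊗[K] H)
    (hS : qtMk K H (fun a => α a) (fun a => β a) 2 S = D.Δ h) : hlpB D a S = h * β a := by
  have h1 := D.Δ_bimod_right a 1 1 D.Δ_one.symm
  have h2 := D.Δ_mul h (β a * 1) S _ hS h1.symm
  have h3 : hlpB D 1 (S * (((1 : H) ⊗ₜ[K] (β a)) * (1 : H ⊗[K] H))) = h * (β a * 1) :=
    hlp_counit_right D _ _ h2.symm
  rw [mul_one, mul_one] at h3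
  rw [← h3]
  clear hS h2 h3
  induction S using TensorProduct.induction_on with
  | zero => rw [zero_mul, map_zero, map_zero]
  | tmul x y =>
    rw [Algebra.TensorProduct.tmul_mul_tmul, hlpB_tmul, hlpB_tmul, hlpAct_apply, hlpAct_apply,
      map_one, mul_one, mul_one, hlp_ε_β]
  | add x y hx hy => rw [add_mul, map_add, map_add, hx, hy]

theorem hlpM_lift (a b : R) (h : H) (S : H ⊗[K] H)
    (hS : qtMk K H (fun a => α a) (fun a => β a) 2 S = D.Δ h) :
    hlpM D a b S = hlpAct D (a * b) h := by
  have h1 : hlpM D a b S = hlpAct D b (hlpA D a S) := by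
    clear hS
    induction S using TensorProduct.induction_on with
    | zero => simp only [map_zero]
    | tmul x y => rw [hlpM_tmul, hlpA_tmul, hlpAct_α]
    | add x y hx hy => simp only [map_add, hx, hy]
  rw [h1, hlpA_lift D a h S hS, hlpAct_apply, hlpAct_apply, map_mul α, mul_assoc]

theorem hlpA_mul (a : R) (S : H ⊗[K] H) (f g : H) :
    hlpA D a (S * (f ⊗ₜ g)) = hlpA D (hlpAct D a f) S * g := by
  induction S using TensorProduct.induction_on with
  | zero => simp only [map_zero, zero_mul]
  | tmul x y =>
    rw [Algebra.TensorProduct.tmul_mul_tmul, hlpA_tmul, hlpA_tmul, hlpAct_mul, mul_assoc]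
  | add x y hx hy => rw [add_mul, map_add, map_add, hx, hy, add_mul]

theorem hlpB_mul (a : R) (S : H ⊗[K] H) (f g : H) :
    hlpB D a (S * (f ⊗ₜ g)) = hlpB D (hlpAct D a g) S * f := by
  induction S using TensorProduct.induction_on with
  | zero => simp only [map_zero, zero_mul]
  | tmul x y =>
    rw [Algebra.TensorProduct.tmul_mul_tmul, hlpB_tmul, hlpB_tmul, hlpAct_mul, mul_assoc]
  | add x y hx hy => rw [add_mul, map_add, map_add, hx, hy, add_mul]

theorem hlpM_mul (a b : R) (S : H ⊗[K] H) (f g : H) :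
    hlpM D a b (S * (f ⊗ₜ g)) = hlpM D (hlpAct D a f) (hlpAct D b g) S := by
  induction S using TensorProduct.induction_on with
  | zero => simp only [map_zero, zero_mul]
  | tmul x y =>
    rw [Algebra.TensorProduct.tmul_mul_tmul, hlpM_tmul, hlpM_tmul, hlpAct_mul, hlpAct_mul]
  | add x y hx hy => rw [add_mul, map_add, map_add, hx, hy]

theorem hlp_assoc_mul (x y : H) (S w : H ⊗[K] H) :
    (TensorProduct.assoc K H H H).symm (x ⊗ₜ S) * (TensorProduct.assoc K H H H).symm (y ⊗ₜ w)
      = (TensorProduct.assoc K H H H).symm ((x * y) ⊗ₜ (S * w)) := by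
  have := map_mul (Algebra.TensorProduct.assoc K K K H H H).symm (x ⊗ₜ S) (y ⊗ₜ w)
  rw [Algebra.TensorProduct.tmul_mul_tmul] at this
  exact this.symm

/-- (T1) evaluated by a balanced map -/
theorem hlp_T1 {C : ℕ} {p q : Fin C → H} {s t : Fin C → H ⊗[K] H}
    (hT1 : TwistorEq1 D p q s t)
    {M : Type u} [AddCommGroup M] [Module K M]
    (f : (H ⊗[K] H) ⊗[K] H →ₗ[K] M)
    (h1 : ∀ r x y z, f (((β r * x) ⊗ₜ y) ⊗ₜ z) = f ((x ⊗ₜ (α r * y)) ⊗ₜ z))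
    (h2 : ∀ r x y z, f ((x ⊗ₜ (β r * y)) ⊗ₜ z) = f ((x ⊗ₜ y) ⊗ₜ (α r * z))) :
    ∑ c, ∑ d, f ((s c * (p d ⊗ₜ q d : H ⊗[K] H)) ⊗ₜ q c) =
    ∑ c, ∑ d, f ((TensorProduct.assoc K H H H).symm
      (p c ⊗ₜ (t c * (p d ⊗ₜ q d : H ⊗[K] H)))) := by
  have key := hlp_fac3 (α := α) (β := β) f h1 h2 _ _ hT1
  have key2 : f ((∑ c, (s c ⊗ₜ[K] q c : (H ⊗[K] H) ⊗[K] H)) *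
        (∑ c, ((p c ⊗ₜ[K] q c : H ⊗[K] H) ⊗ₜ[K] (1 : H) : (H ⊗[K] H) ⊗[K] H))) =
      f ((∑ c, (TensorProduct.assoc K H H H).symm (p c ⊗ₜ[K] t c)) *
        (∑ c, (TensorProduct.assoc K H H H).symm ((1 : H) ⊗ₜ[K] (p c ⊗ₜ[K] q c)))) := key
  simp only [Finset.sum_mul_sum, hlp_assoc_mul, Algebra.TensorProduct.tmul_mul_tmul, mul_one,
    map_sum] at key2
  exact key2

end Helpers

/-! ### STATEMENT 10 -/

/-- **The twisted source and target maps (Xu).**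
Under the hypotheses (T1), (T2) on `F = Σ_c (p c) ⊗_R (q c) ∈ H ⊗_R H`, the maps
`α_F(a) := α(F₁ ▷ a) · F₂` and `β_F(a) := β(F₂ ▷ a) · F₁` are, respectively, an algebra
homomorphism and an algebra anti-homomorphism from `R_F = (R, ⋆_F)` to `H`, their images
commute, and `F · (β_F(a) ⊗ 1 − 1 ⊗ α_F(a)) = 0` in `H ⊗_R H` for all `a ∈ R`. -/
theorem twistorEqs_twisted_source_target
    (K : Type u) [Field K] [CharZero K]
    (H : Type u) [Ring H] [Algebra K H]
    (R : Type u) [Ring R] [Algebra K R]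
    (α : R →ₐ[K] H) (β : R →ₗ[K] H)
    (D : HopfAlgebroid K H R α β)
    (C : ℕ) (p q : Fin C → H) (s t : Fin C → TP K H 2)
    (hs : ∀ c, qtMk K H (fun a => α a) (fun a => β a) 2 (s c) = D.Δ (p c))
    (ht : ∀ c, qtMk K H (fun a => α a) (fun a => β a) 2 (t c) = D.Δ (q c))
    (hT1 : TwistorEq1 D p q s t) (hT2 : TwistorEq2 D p q) :
    -- `α_F` is an algebra homomorphism on `R_F`
    (∀ a b : R, alphaF D p q (starF D p q a b) = alphaF D p q a * alphaF D p q b) ∧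
    (alphaF D p q 1 = 1) ∧
    -- `β_F` is an algebra anti-homomorphism on `R_F`
    (∀ a b : R, betaF D p q (starF D p q a b) = betaF D p q b * betaF D p q a) ∧
    (betaF D p q 1 = 1) ∧
    -- the images of `α_F` and `β_F` commute
    (∀ a b : R, alphaF D p q a * betaF D p q b = betaF D p q b * alphaF D p q a) ∧
    -- `F · (β_F(a) ⊗ 1 − 1 ⊗ α_F(a)) = 0`
    (∀ a : R,
      qtMk K H (fun a => α a) (fun a => β a) 2
        ((∑ c, (p c ⊗ₜ[K] q c : TP K H 2)) *
          (((betaF D p q a : H) ⊗ₜ[K] (1 : H) : TP K H 2) -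
            ((1 : H) ⊗ₜ[K] alphaF D p q a : TP K H 2))) = 0) := by
  revert s t
  intro (s : Fin C → H ⊗[K] H) (t : Fin C → H ⊗[K] H) hs ht hT1
  have hα : ∀ a, alphaF D p q a = ∑ c, α (hlpAct D a (p c)) * q c := fun a => rfl
  have hβ : ∀ a, betaF D p q a = ∑ c, β (hlpAct D a (q c)) * p c := fun a => rfl
  have hst : ∀ a b, starF D p q a b = ∑ c, hlpAct D a (p c) * hlpAct D b (q c) :=
    fun a b => rfl
  have hsumA : ∀ (h : H) (F : Fin C → R), hlpAct D (∑ d, F d) h = ∑ d, hlpAct D (F d) h := by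
    intro h F
    simp only [hlpAct_apply, map_sum, Finset.mul_sum]
  have sA := fun a c => hlpA_lift D a (p c) (s c) (hs c)
  have sB := fun a c => hlpB_lift D a (p c) (s c) (hs c)
  have sM := fun a b c => hlpM_lift D a b (p c) (s c) (hs c)
  have tA := fun a c => hlpA_lift D a (q c) (t c) (ht c)
  have tB := fun a c => hlpB_lift D a (q c) (t c) (ht c)
  have tM := fun a b c => hlpM_lift D a b (q c) (t c) (ht c)
  refine ⟨?_, ?_, ?_, ?_, ?_, ?_⟩
  · intro a b
    have key := hlp_T1 D hT1 (TensorProduct.lift ((LinearMap.mul K H).compl₁₂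
      (α.toLinearMap ∘ₗ hlpM D a b) LinearMap.id)) ?_ ?_
    · have e1 : ∀ (S : H ⊗[K] H) (z : H), (TensorProduct.lift ((LinearMap.mul K H).compl₁₂
          (α.toLinearMap ∘ₗ hlpM D a b) LinearMap.id)) (S ⊗ₜ z) = α (hlpM D a b S) * z :=
        fun S z => rfl
      have e2 : ∀ (S : H ⊗[K] H) (x : H), (TensorProduct.lift ((LinearMap.mul K H).compl₁₂
          (α.toLinearMap ∘ₗ hlpM D a b) LinearMap.id))
            ((TensorProduct.assoc K H H H).symm (x ⊗ₜ S)) = α (hlpAct D a x) * hlpA D b S := by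
        intro S x
        induction S using TensorProduct.induction_on with
        | zero => simp only [TensorProduct.tmul_zero, map_zero, mul_zero]
        | tmul y z =>
          rw [TensorProduct.assoc_symm_tmul, e1, hlpM_tmul, hlpA_tmul, map_mul, mul_assoc]
        | add y z hy hz => rw [TensorProduct.tmul_add, map_add, map_add, hy, hz, map_add, mul_add]
      simp only [e1, e2, hlpM_mul, hlpA_mul, sM, tA] at key
      rw [hα, hst, hα, hα, Finset.sum_mul_sum]
      simp only [hsumA, map_sum, Finset.sum_mul]
      rw [key]
      simp only [mul_assoc]
    · intro r x y z
      change α (hlpAct D a (β r * x) * hlpAct D b y) * z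
        = α (hlpAct D a x * hlpAct D b (α r * y)) * z
      rw [hlpAct_α, hlpAct_β, mul_assoc]
    · intro r x y z
      change α (hlpAct D a x * hlpAct D b (β r * y)) * z
        = α (hlpAct D a x * hlpAct D b y) * (α r * z)
      rw [hlpAct_β, ← mul_assoc, map_mul, mul_assoc]
  · rw [hα]
    simp only [hlpAct_apply, map_one, mul_one]
    exact hT2.1
  · intro a b
    have key := hlp_T1 D hT1 (TensorProduct.lift ((LinearMap.mul K H).flip.compl₁₂
      (hlpB D a) (β ∘ₗ hlpAct D b))) ?_ ?_
    · have e1 : ∀ (S : H ⊗[K] H) (z : H), (TensorProduct.lift ((LinearMap.mul K H).flip.compl₁₂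
          (hlpB D a) (β ∘ₗ hlpAct D b))) (S ⊗ₜ z) = β (hlpAct D b z) * hlpB D a S :=
        fun S z => rfl
      have e2 : ∀ (S : H ⊗[K] H) (x : H), (TensorProduct.lift ((LinearMap.mul K H).flip.compl₁₂
          (hlpB D a) (β ∘ₗ hlpAct D b)))
            ((TensorProduct.assoc K H H H).symm (x ⊗ₜ S)) = β (hlpM D a b S) * x := by
        intro S x
        induction S using TensorProduct.induction_on with
        | zero => simp only [TensorProduct.tmul_zero, map_zero, zero_mul]
        | tmul y z =>
          rw [TensorProduct.assoc_symm_tmul, e1, hlpM_tmul, hlpB_tmul, D.β_mul, mul_assoc]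
        | add y z hy hz =>
          rw [TensorProduct.tmul_add, map_add, map_add, hy, hz, map_add, map_add, add_mul]
      simp only [e1, e2, hlpM_mul, hlpB_mul, sB, tM] at key
      rw [hβ, hst, hβ, hβ, Finset.sum_mul_sum]
      simp only [hsumA, map_sum, Finset.sum_mul]
      rw [← key]
      simp only [mul_assoc]
    · intro r x y z
      change β (hlpAct D b z) * (β (hlpAct D a y) * (β r * x))
        = β (hlpAct D b z) * (β (hlpAct D a (α r * y)) * x)
      rw [hlpAct_α, D.β_mul, mul_assoc]
    · intro r x y z
      change β (hlpAct D b z) * (β (hlpAct D a (β r * y)) * x)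
        = β (hlpAct D b (α r * z)) * (β (hlpAct D a y) * x)
      rw [hlpAct_α, hlpAct_β, D.β_mul, D.β_mul, mul_assoc, mul_assoc]
  · rw [hβ]
    simp only [hlpAct_apply, map_one, mul_one]
    exact hT2.2
  · intro a b
    have key := hlp_T1 D hT1 (TensorProduct.lift ((LinearMap.mul K H).flip.compl₁₂
      (hlpA D a) (β ∘ₗ hlpAct D b))) ?_ ?_
    · have e1 : ∀ (S : H ⊗[K] H) (z : H), (TensorProduct.lift ((LinearMap.mul K H).flip.compl₁₂
          (hlpA D a) (β ∘ₗ hlpAct D b))) (S ⊗ₜ z) = β (hlpAct D b z) * hlpA D a S :=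
        fun S z => rfl
      have e2 : ∀ (S : H ⊗[K] H) (x : H), (TensorProduct.lift ((LinearMap.mul K H).flip.compl₁₂
          (hlpA D a) (β ∘ₗ hlpAct D b)))
            ((TensorProduct.assoc K H H H).symm (x ⊗ₜ S)) = α (hlpAct D a x) * hlpB D b S := by
        intro S x
        induction S using TensorProduct.induction_on with
        | zero => simp only [TensorProduct.tmul_zero, map_zero, mul_zero]
        | tmul y z =>
          rw [TensorProduct.assoc_symm_tmul, e1, hlpA_tmul, hlpB_tmul, ← mul_assoc, ← mul_assoc,
            D.αβ_comm]
        | add y z hy hz =>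
          rw [TensorProduct.tmul_add, map_add, map_add, hy, hz, map_add, mul_add]
      simp only [e1, e2, hlpA_mul, hlpB_mul, sA, tB] at key
      rw [hβ, hα, Finset.sum_mul_sum, Finset.sum_mul_sum]
      simp only [mul_assoc] at key ⊢
      exact key.symm
    · intro r x y z
      change β (hlpAct D b z) * (α (hlpAct D a (β r * x)) * y)
        = β (hlpAct D b z) * (α (hlpAct D a x) * (α r * y))
      rw [hlpAct_β, map_mul, mul_assoc]
    · intro r x y z
      change β (hlpAct D b z) * (α (hlpAct D a x) * (β r * y))
        = β (hlpAct D b (α r * z)) * (α (hlpAct D a x) * y)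
      rw [hlpAct_α, D.β_mul, ← mul_assoc (α _), D.αβ_comm, mul_assoc, mul_assoc]
  · intro a
    have bal : ∀ (r : R) (x z : H),
        qtMk K H (fun a => α a) (fun a => β a) 2 ((β r * x) ⊗ₜ[K] z : H ⊗[K] H)
        = qtMk K H (fun a => α a) (fun a => β a) 2 (x ⊗ₜ[K] (α r * z) : H ⊗[K] H) := by
      intro r x z
      refine (Submodule.Quotient.eq _).2 (Submodule.subset_span ⟨r, 0, (x ⊗ₜ[K] z : H ⊗[K] H),
        le_refl _, ?_⟩)
      change ((β r * x) ⊗ₜ[K] z - x ⊗ₜ[K] (α r * z) : H ⊗[K] H)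
        = ((β r) ⊗ₜ[K] (1 : H) - (1 : H) ⊗ₜ[K] (α r) : H ⊗[K] H) * (x ⊗ₜ[K] z)
      rw [sub_mul]
      simp only [Algebra.TensorProduct.tmul_mul_tmul, one_mul]
    let Q : H ⊗[K] H →ₗ[K] QT K H (fun a => α a) (fun a => β a) 2 :=
      qtMk K H (fun a => α a) (fun a => β a) 2
    have bal' : ∀ (r : R) (x z : H), Q ((β r * x) ⊗ₜ[K] z) = Q (x ⊗ₜ[K] (α r * z)) := bal
    have key := hlp_T1 D hT1 (Q ∘ₗ TensorProduct.map (hlpB D a) LinearMap.id) ?_ ?_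
    · have e1 : ∀ (S : H ⊗[K] H) (z : H), (Q ∘ₗ TensorProduct.map (hlpB D a) LinearMap.id)
          (S ⊗ₜ z) = Q (hlpB D a S ⊗ₜ z) :=
        fun S z => rfl
      have e2 : ∀ (S : H ⊗[K] H) (x : H), (Q ∘ₗ TensorProduct.map (hlpB D a) LinearMap.id)
            ((TensorProduct.assoc K H H H).symm (x ⊗ₜ S)) = Q (x ⊗ₜ hlpA D a S) := by
        intro S x
        induction S using TensorProduct.induction_on with
        | zero => simp only [TensorProduct.tmul_zero, map_zero]
        | tmul y z =>
          rw [TensorProduct.assoc_symm_tmul, e1, hlpA_tmul, hlpB_tmul, bal']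
        | add y z hy hz =>
          rw [TensorProduct.tmul_add, map_add, map_add, hy, hz, map_add, TensorProduct.tmul_add,
            map_add]
      simp only [e1, e2, hlpA_mul, hlpB_mul, sB, tA] at key
      change Q ((∑ c, (p c ⊗ₜ[K] q c : H ⊗[K] H)) * (((betaF D p q a : H) ⊗ₜ[K] (1 : H)) -
            ((1 : H) ⊗ₜ[K] alphaF D p q a))) = 0
      rw [hβ, hα, mul_sub, map_sub, sub_eq_zero]
      simp only [TensorProduct.sum_tmul, TensorProduct.tmul_sum, Finset.sum_mul_sum,
        Algebra.TensorProduct.tmul_mul_tmul, mul_one, map_sum]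
      simp only [mul_assoc] at key ⊢
      exact key
    · intro r x y z
      change Q ((β (hlpAct D a y) * (β r * x)) ⊗ₜ z) = Q ((β (hlpAct D a (α r * y)) * x) ⊗ₜ z)
      rw [hlpAct_α, D.β_mul, mul_assoc]
    · intro r x y z
      change Q ((β (hlpAct D a (β r * y)) * x) ⊗ₜ z) = Q ((β (hlpAct D a y) * x) ⊗ₜ (α r * z))
      rw [hlpAct_β, D.β_mul, mul_assoc, bal']
end
end

section
/- Let (𝔤, 𝔩) be a Lie algebra pair over K. If B ∈ (U(𝔤)^{⊗m}⊗U(𝔩)⟦ℏ⟧)^𝔩 and C ∈ (U(𝔤)^{⊗p}⊗U(𝔩)⟦ℏ⟧)^𝔩 are 𝔩-invariant, and i, j, r are integers with 1 ≤ i, i+m ≤ j, and j+p ≤ r, then the elements ι_{i,r}(B) and ι_{j,r}(C) commute in U(𝔤)^{⊗(r−1)}⊗U(𝔩)⟦ℏ⟧: ι_{i,r}(B)·ι_{j,r}(C) = ι_{j,r}(C)·ι_{i,r}(B). -/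
/-! # Preliminaries: Hopf algebroids in the sense of Xu

We fix a field `K` of characteristic zero, an associative unital `K`-algebra `R` and an
associative unital `K`-algebra `H`.  We construct the `n`-fold tensor powers
`H^{⊗_K n}` of `H` over `K` and, given source and target maps `α, β : R → H`, the
quotients `H^{⊗_R n}` of `H^{⊗_K n}` by the right ideal `I_n` generated by the elements
`1 ⊗ ⋯ ⊗ β(r) ⊗ 1 ⊗ ⋯ ⊗ 1 − 1 ⊗ ⋯ ⊗ 1 ⊗ α(r) ⊗ ⋯ ⊗ 1`.

A Hopf algebroid is then given by the data `(H, α, β, ·, Δ, ε)` subject to the axioms of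
Xu; the iterated coproducts `Δⁿ = (Δ^{n−1} ⊗_R id) ∘ Δ` are part of the data, uniquely
characterized by their recursion.  All axioms involving maps induced on the quotients
`H^{⊗_R n}` are stated equivalently in terms of (arbitrary) lifts along the quotient
maps and (arbitrary) presentations of elements as sums of pure tensors. -/

noncomputable section

open scoped TensorProduct

universe u

variable (K : Type u) [Field K] [CharZero K]

variable (H : Type u) [Ring H] [Algebra K H]

variable {R : Type u} [Ring R] [Algebra K R]

variable (R)

/-! ### Lie algebra pairs and the spaces `(U(𝔤)^{⊗n} ⊗ U(𝔩)⟦ℏ⟧)^𝔩` -/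

section LiePair

variable (K : Type u) [Field K] [CharZero K]

/-- The iterated coproducts `Dⁿ : H → H^{⊗(n+1)}` of a coproduct `Δ' : H → H ⊗ H`
on a `K`-algebra `H`. -/
def DpowG (H : Type u) [Ring H] [Algebra K H] (Δ' : H →ₗ[K] TP K H 2) :
    ∀ n : ℕ, H →ₗ[K] TP K H (n + 1)
  | 0 => LinearMap.id
  | (n + 1) =>
      (show ((H ⊗[K] H) →ₗ[K] TP K H (n + 2)) from
        LinearMap.rTensor H (DpowG H Δ' n)).comp Δ'

variable (L : Type u) [LieRing L] [LieAlgebra K L] [Module.Finite K L]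
variable (𝔩 : LieSubalgebra K L)

/-- `U(𝔤)`, the universal enveloping algebra of `𝔤 = L`. -/
abbrev Ug : Type u := UniversalEnvelopingAlgebra K L

/-- `U(𝔩)`, the universal enveloping algebra of the Lie subalgebra `𝔩 ⊆ 𝔤`. -/
abbrev Ul : Type u := UniversalEnvelopingAlgebra K 𝔩

attribute [local instance 100] LieRing.ofAssociativeRing

/-- The inclusion `U(𝔩) → U(𝔤)` induced by `𝔩 ⊆ 𝔤`. -/
noncomputable def inclUE : Ul K L 𝔩 →ₐ[K] Ug K L :=
  UniversalEnvelopingAlgebra.lift K ((UniversalEnvelopingAlgebra.ι K).comp 𝔩.incl)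

/-- `Δg` is the standard Hopf-algebra coproduct of `U(𝔤)`:
`Δ(x) = x ⊗ 1 + 1 ⊗ x` for `x ∈ 𝔤`. -/
def IsUECoproduct (Δg : Ug K L →ₐ[K] TP K (Ug K L) 2) : Prop :=
  ∀ x : L, Δg (UniversalEnvelopingAlgebra.ι K x) =
    (show TP K (Ug K L) 2 from
      (UniversalEnvelopingAlgebra.ι K x) ⊗ₜ[K] 1 + 1 ⊗ₜ[K] (UniversalEnvelopingAlgebra.ι K x))

/-- `εg` is the standard counit of `U(𝔤)`: `ε(x) = 0` for `x ∈ 𝔤`. -/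
def IsUECounit (εg : Ug K L →ₐ[K] K) : Prop :=
  ∀ x : L, εg (UniversalEnvelopingAlgebra.ι K x) = 0

/-- The subspace `U(𝔤)^{⊗n} ⊗ U(𝔩) ⊆ U(𝔤)^{⊗(n+1)}`. -/
def lastSub (n : ℕ) : Submodule K (TP K (Ug K L) (n + 1)) :=
  Submodule.span K
    {z | ∃ (x : Fin n → Ug K L) (b : Ul K L 𝔩),
      z = chainP K (Ug K L) (n + 1) (Fin.snoc x (inclUE K L 𝔩 b))}

/-- `A ∈ (U(𝔤)^{⊗n} ⊗ U(𝔩)⟦ℏ⟧)^𝔩`: a formal power series whose coefficients lie in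
`U(𝔤)^{⊗n} ⊗ U(𝔩)` and which is `𝔩`-invariant, `Δⁿ(l) · A = A · Δⁿ(l)` for `l ∈ 𝔩`. -/
def Memb (Δg : Ug K L →ₐ[K] TP K (Ug K L) 2) (n : ℕ)
    (A : PowerSeries (TP K (Ug K L) (n + 1))) : Prop :=
  (∀ d : ℕ, (PowerSeries.coeff d) A ∈ lastSub K L 𝔩 n) ∧
  (∀ l : 𝔩,
    (PowerSeries.C (DpowG K (Ug K L) Δg.toLinearMap n
        (UniversalEnvelopingAlgebra.ι K (l : L)))) * A =
      A * (PowerSeries.C (DpowG K (Ug K L) Δg.toLinearMap n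
        (UniversalEnvelopingAlgebra.ι K (l : L)))))

/-- Transport of power series along an equality of tensor degrees. -/
def psCast {a b : ℕ} (h : a = b) (A : PowerSeries (TP K (Ug K L) a)) :
    PowerSeries (TP K (Ug K L) b) := h ▸ A

/-- The defining clause for the map `ι_{i,r}` (`1 ≤ i`, `i + m ≤ r`):
`ι_{i,r}(B₁ ⊗ ⋯ ⊗ B_m ⊗ B_{m+1}) = 1^{⊗(i−1)} ⊗ B₁ ⊗ ⋯ ⊗ B_m ⊗ Δ^{r−i−m}(B_{m+1})`,
stated coefficientwise on generators, via presentations of the iterated coproducts as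
sums of pure tensors. -/
def IsIotaMap (Δg : Ug K L →ₐ[K] TP K (Ug K L) 2) (m i r : ℕ)
    (ιf : TP K (Ug K L) (m + 1) →ₗ[K] TP K (Ug K L) r) : Prop :=
  ∀ (x : Fin m → Ug K L) (b : Ul K L 𝔩) (CZ : ℕ)
    (Z : Fin CZ → Fin (r - i - m + 1) → Ug K L),
    (∑ c, chainP K (Ug K L) (r - i - m + 1) (Z c)) =
      DpowG K (Ug K L) Δg.toLinearMap (r - i - m) (inclUE K L 𝔩 b) →
    ιf (chainP K (Ug K L) (m + 1) (Fin.snoc x (inclUE K L 𝔩 b))) =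
      ∑ c, chainP K (Ug K L) r (fun t : Fin r =>
        if _ : (t : ℕ) < i - 1 then 1
        else if h2 : (t : ℕ) < i - 1 + m then x ⟨(t : ℕ) - (i - 1), by omega⟩
        else Z c ⟨(t : ℕ) - (i - 1) - m, by have := t.isLt; omega⟩)

end LiePair
section Aux

set_option linter.unusedSectionVars false

variable {A : Type u} [Ring A] [Algebra K A]

/-- left inclusion -/
def inclL (n : ℕ) : TP K H (n + 1) →ₐ[K] TP K H (n + 2) :=
  (Algebra.TensorProduct.includeLeft : TP K H (n + 1) →ₐ[K] TP K H (n + 1) ⊗[K] H)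

/-- right inclusion -/
def inclR (n : ℕ) : H →ₐ[K] TP K H (n + 2) :=
  (Algebra.TensorProduct.includeRight : H →ₐ[K] TP K H (n + 1) ⊗[K] H)

/-- lift from a tensor product -/
def liftStep (n : ℕ) (f : TP K H (n + 1) →ₐ[K] A) (g : H →ₐ[K] A)
    (h : ∀ x y, Commute (f x) (g y)) : TP K H (n + 2) →ₐ[K] A :=
  (Algebra.TensorProduct.lift f g h : TP K H (n + 1) ⊗[K] H →ₐ[K] A)

theorem inclL_mul_inclR (n : ℕ) (x : TP K H (n + 1)) (y : H) :
    inclL K H n x * inclR K H n y = (x ⊗ₜ[K] y : TP K H (n + 1) ⊗[K] H) := by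
  have : ((x ⊗ₜ[K] (1 : H)) * ((1 : TP K H (n + 1)) ⊗ₜ[K] y) : TP K H (n + 1) ⊗[K] H)
      = x ⊗ₜ[K] y := by simp
  exact this

theorem inclL_comm_inclR (n : ℕ) (x : TP K H (n + 1)) (y : H) :
    Commute (inclL K H n x) (inclR K H n y) := by
  have : ((x ⊗ₜ[K] (1 : H)) * ((1 : TP K H (n + 1)) ⊗ₜ[K] y) : TP K H (n + 1) ⊗[K] H)
      = ((1 : TP K H (n + 1)) ⊗ₜ[K] y) * (x ⊗ₜ[K] (1 : H)) := by simp
  exact this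

theorem liftStep_inclL (n : ℕ) (f : TP K H (n + 1) →ₐ[K] A) (g : H →ₐ[K] A)
    (h : ∀ x y, Commute (f x) (g y)) (x) : liftStep K H n f g h (inclL K H n x) = f x := by
  have : (Algebra.TensorProduct.lift f g h : TP K H (n + 1) ⊗[K] H →ₐ[K] A) (x ⊗ₜ[K] 1) = f x := by
    simp
  exact this

theorem liftStep_inclR (n : ℕ) (f : TP K H (n + 1) →ₐ[K] A) (g : H →ₐ[K] A)
    (h : ∀ x y, Commute (f x) (g y)) (x) : liftStep K H n f g h (inclR K H n x) = g x := by
  have : (Algebra.TensorProduct.lift f g h : TP K H (n + 1) ⊗[K] H →ₐ[K] A) (1 ⊗ₜ[K] x) = g x := by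
    simp
  exact this

theorem TP_ind (n : ℕ) {P : TP K H (n + 2) → Prop} (h0 : P 0)
    (hm : ∀ x y, P (inclL K H n x * inclR K H n y))
    (ha : ∀ x y, P x → P y → P (x + y)) (z) : P z := by
  refine TensorProduct.induction_on (R := K) (M := TP K H (n + 1)) (N := H) z h0 ?_ ha
  intro x y
  have := hm x y
  rwa [inclL_mul_inclR] at this

/-- slots as algebra homs -/
def slotHom : (n : ℕ) → ℕ → H →ₐ[K] TP K H (n + 1)
  | 0, _ => AlgHom.id K H
  | (n + 1), i => if i = n + 1 then inclR K H n else (inclL K H n).comp (slotHom n i)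

theorem slotHom_eq (n i : ℕ) (h : H) : slotHom K H n i h = slotP K H (n + 1) i h := by
  induction n with
  | zero => rfl
  | succ n ih =>
    by_cases hi : i = n + 1
    · simp only [slotHom, slotP, hi, if_true]; rfl
    · simp only [slotHom, slotP, hi, if_false, ← ih]; rfl

theorem slotHom_last (n : ℕ) : slotHom K H (n + 1) (n + 1) = inclR K H n := by
  simp [slotHom]

theorem slotHom_init (n i : ℕ) (hi : i ≤ n) :
    slotHom K H (n + 1) i = (inclL K H n).comp (slotHom K H n i) := by
  have : i ≠ n + 1 := by omega
  simp [slotHom, this]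

theorem slotHom_comm (n : ℕ) : ∀ k l, k ≤ n → l ≤ n → k ≠ l → ∀ x y,
    Commute (slotHom K H n k x) (slotHom K H n l y) := by
  induction n with
  | zero => intros; omega
  | succ n ih =>
    intro k l hk hl hkl x y
    rcases Nat.lt_or_ge n k with h1 | h1
    · obtain rfl : k = n + 1 := by omega
      rw [slotHom_last, slotHom_init K H n l (by omega)]
      exact (inclL_comm_inclR K H n _ _).symm
    · rcases Nat.lt_or_ge n l with h2 | h2
      · obtain rfl : l = n + 1 := by omega
        rw [slotHom_last, slotHom_init K H n k (by omega)]
        exact (inclL_comm_inclR K H n _ _)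
      · rw [slotHom_init K H n k h1, slotHom_init K H n l h2]
        exact (ih k l h1 h2 hkl x y).map (inclL K H n)

theorem slot_gen (n : ℕ) : ∀ S : Subalgebra K (TP K H (n + 1)),
    (∀ k ≤ n, ∀ h, slotHom K H n k h ∈ S) → ∀ z, z ∈ S := by
  induction n with
  | zero => intro S hS z; exact hS 0 le_rfl z
  | succ n ih =>
    intro S hS z
    refine TP_ind K H n S.zero_mem ?_ (fun x y => S.add_mem) z
    intro x y
    refine S.mul_mem ?_ ?_
    · refine ih (S.comap (inclL K H n)) ?_ x
      intro k hk h
      have := hS k (by omega) h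
      rwa [slotHom_init K H n k hk] at this
    · have := hS (n + 1) le_rfl y
      rwa [slotHom_last] at this

theorem comm_of_slots (n : ℕ) (F : TP K H (n + 1) →ₐ[K] A) (a : A)
    (h : ∀ k ≤ n, ∀ x, Commute (F (slotHom K H n k x)) a) (z) : Commute (F z) a := by
  have := slot_gen K H n ((Subalgebra.centralizer K {a}).comap F) (by
    intro k hk x
    simp only [Subalgebra.mem_comap, Subalgebra.mem_centralizer_iff, Set.mem_singleton_iff,
      forall_eq]
    exact (h k hk x).symm) z
  simp only [Subalgebra.mem_comap, Subalgebra.mem_centralizer_iff, Set.mem_singleton_iff,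
      forall_eq] at this
  exact Commute.symm this

theorem exists_lift (n : ℕ) (f : ℕ → H →ₐ[K] A)
    (hc : ∀ k l, k ≤ n → l ≤ n → k ≠ l → ∀ x y, Commute (f k x) (f l y)) :
    ∃ F : TP K H (n + 1) →ₐ[K] A, ∀ k ≤ n, ∀ h, F (slotHom K H n k h) = f k h := by
  induction n with
  | zero => 
    refine ⟨f 0, ?_⟩
    intro k hk h
    obtain rfl : k = 0 := by omega
    rfl
  | succ n ih =>
    obtain ⟨F, hF⟩ := ih (fun k l hk hl => hc k l (by omega) (by omega))
    refine ⟨liftStep K H n F (f (n + 1)) ?_, ?_⟩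
    · intro x y
      refine comm_of_slots K H n F _ ?_ x
      intro k hk x
      rw [hF k hk]
      exact hc _ _ (by omega) le_rfl (by omega) _ _
    · intro k hk h
      rcases Nat.lt_or_ge n k with h1 | h1
      · obtain rfl : k = n + 1 := by omega
        rw [slotHom_last, liftStep_inclR]
      · rw [slotHom_init K H n k h1, AlgHom.comp_apply, liftStep_inclL, hF k h1]

/-- the iterated coproduct as an algebra hom -/
def DH (D : H →ₐ[K] TP K H 2) : (n : ℕ) → H →ₐ[K] TP K H (n + 1)
  | 0 => AlgHom.id K H
  | (n + 1) => (liftStep K H 0 ((inclL K H n).comp (DH D n) : H →ₐ[K] TP K H (n + 2)) (inclR K H n)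
      (fun _ _ => inclL_comm_inclR K H n _ _)).comp D

theorem DH_eq (D : H →ₐ[K] TP K H 2) (n : ℕ) (x : H) :
    DH K H D n x = DpowG K H D.toLinearMap n x := by
  induction n generalizing x with
  | zero => rfl
  | succ n ih =>
    have key : ∀ z : TP K H 2,
      liftStep K H 0 ((inclL K H n).comp (DH K H D n) : H →ₐ[K] TP K H (n + 2)) (inclR K H n)
      (fun _ _ => inclL_comm_inclR K H n _ _) z =
        (LinearMap.rTensor H (DpowG K H D.toLinearMap n) :
          H ⊗[K] H →ₗ[K] TP K H (n + 1) ⊗[K] H) z := by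
      intro z
      refine TP_ind K H 0 (P := fun z => liftStep K H 0 ((inclL K H n).comp (DH K H D n) : H →ₐ[K] TP K H (n + 2)) (inclR K H n)
        (fun _ _ => inclL_comm_inclR K H n _ _) z =
        (LinearMap.rTensor H (DpowG K H D.toLinearMap n) :
          H ⊗[K] H →ₗ[K] TP K H (n + 1) ⊗[K] H) z) ?_ ?_ ?_ z
      · rw [map_zero]; exact (map_zero (LinearMap.rTensor H (DpowG K H D.toLinearMap n))).symm
      · intro a b
        rw [map_mul]
        refine (congrArg₂ (· * ·) (liftStep_inclL K H 0 _ _ _ _)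
          (liftStep_inclR K H 0 _ _ _ _)).trans ?_
        refine (inclL_mul_inclR K H n (DH K H D n a) b).trans ?_
        refine (congrArg (fun w : TP K H (n + 1) => (w ⊗ₜ[K] b : TP K H (n + 1) ⊗[K] H))
          (ih a)).trans ?_
        rw [inclL_mul_inclR]
        exact (LinearMap.rTensor_tmul H (DpowG K H D.toLinearMap n) b a).symm
      · intro a b ha hb
        rw [map_add, ha, hb]
        exact (map_add (LinearMap.rTensor H (DpowG K H D.toLinearMap n)) a b).symm
    exact key (D x)

theorem DH_prim (D : H →ₐ[K] TP K H 2) (x : H)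
    (hx : D x = inclL K H 0 x + inclR K H 0 x) (n : ℕ) :
    DH K H D n x = ∑ k ∈ Finset.range (n + 1), slotHom K H n k x := by
  induction n with
  | zero => simp [DH, slotHom]
  | succ n ih =>
    rw [Finset.sum_range_succ, slotHom_last]
    simp only [DH, AlgHom.comp_apply, hx, map_add]
    refine congrArg₂ (· + ·) ?_ (liftStep_inclR K H 0 _ _ _ _)
    refine (liftStep_inclL K H 0 _ _ _ _).trans ?_
    refine (congrArg (inclL K H n) ih).trans ?_
    rw [map_sum]
    refine Finset.sum_congr rfl fun k hk => ?_
    rw [slotHom_init K H n k (by simpa [Nat.lt_succ_iff] using hk)]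
    rfl

theorem chainP_range (n : ℕ) (y : ℕ → H) :
    chainP K H (n + 1) (fun t => y t) =
      ((List.range (n + 1)).map (fun k => slotHom K H n k (y k))).prod := by
  unfold chainP
  congr 1
  apply List.ext_getElem
  · simp
  · intro i h1 h2
    rw [List.getElem_ofFn]
    simp [slotHom_eq]

theorem exists_chain (n : ℕ) (z : TP K H (n + 1)) :
    ∃ (C : ℕ) (Z : Fin C → ℕ → H), ∑ c, chainP K H (n + 1) (fun t => Z c t) = z := by
  induction n with
  | zero =>
    refine ⟨1, fun _ _ => z, ?_⟩
    rw [Fin.sum_univ_one]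
    refine (chainP_range K H 0 (fun _ => z)).trans ?_
    simp [slotHom]
    rfl
  | succ n ih =>
    refine TP_ind K H n (P := fun z => ∃ (C : ℕ) (Z : Fin C → ℕ → H),
      ∑ c, chainP K H (n + 2) (fun t => Z c t) = z) ⟨0, fun _ _ => 0, by simp⟩ ?_ ?_ z
    · intro x y
      obtain ⟨C, Z, rfl⟩ := ih x
      refine ⟨C, fun c t => if t = n + 1 then y else Z c t, ?_⟩
      rw [map_sum, Finset.sum_mul]
      refine Finset.sum_congr rfl fun c _ => ?_
      rw [chainP_range K H n (Z c),
        chainP_range K H (n + 1) (fun t => if t = n + 1 then y else Z c t)]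
      rw [List.range_succ (n := n + 1), List.map_append, List.prod_append, map_list_prod,
        List.map_map]
      congr 1
      · congr 1
        apply List.map_congr_left
        intro k hk
        have hk' : k ≤ n := by simpa [Nat.lt_succ_iff] using hk
        have : k ≠ n + 1 := by omega
        simp only [this, if_false, slotHom_init K H n k hk']
        rfl
      · simp [slotHom_last]
    · rintro _ _ ⟨C1, Z1, rfl⟩ ⟨C2, Z2, rfl⟩
      refine ⟨C1 + C2, Fin.append Z1 Z2, ?_⟩
      simp [Fin.sum_univ_add]

/-- existence of block embeddings -/
theorem exists_block (R N off : ℕ) (h : off + N ≤ R) :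
    ∃ E : TP K H (N + 1) →ₐ[K] TP K H (R + 1),
      ∀ k ≤ N, ∀ x, E (slotHom K H N k x) = slotHom K H R (off + k) x :=
  exists_lift K H N (fun k => slotHom K H R (off + k))
    (fun k l hk hl hkl => slotHom_comm K H R _ _ (by omega) (by omega) (by omega))

end Aux

theorem iota_formula
    (K : Type u) [Field K] [CharZero K]
    (L : Type u) [LieRing L] [LieAlgebra K L] [Module.Finite K L]
    (𝔩 : LieSubalgebra K L)
    (Δg : Ug K L →ₐ[K] TP K (Ug K L) 2)
    (m i R : ℕ) (hi : 1 ≤ i) (hir : i + m ≤ R + 1)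
    (f : TP K (Ug K L) (m + 1) →ₗ[K] TP K (Ug K L) (R + 1))
    (hf : IsIotaMap K L 𝔩 Δg m i (R + 1) f)
    (E : TP K (Ug K L) (R + 1 - i - m + 1) →ₐ[K] TP K (Ug K L) (R + 1))
    (hE : ∀ k ≤ R + 1 - i - m, ∀ x, E (slotHom K (Ug K L) _ k x) =
      slotHom K (Ug K L) R (i - 1 + m + k) x)
    (x : Fin m → Ug K L) (b : Ul K L 𝔩) :
    f (chainP K (Ug K L) (m + 1) (Fin.snoc x (inclUE K L 𝔩 b))) =
      ((List.range m).map (fun k => slotHom K (Ug K L) R (i - 1 + k)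
        (if h : k < m then x ⟨k, h⟩ else 1))).prod *
      E (DH K (Ug K L) Δg (R + 1 - i - m) (inclUE K L 𝔩 b)) := by
  obtain ⟨C, Z, hZ⟩ := exists_chain K (Ug K L) (R + 1 - i - m)
    (DH K (Ug K L) Δg (R + 1 - i - m) (inclUE K L 𝔩 b))
  rw [hf x b C (fun c t => Z c t) (hZ.trans (DH_eq _ _ _ _ _)), ← hZ, map_sum, Finset.mul_sum]
  refine Finset.sum_congr rfl fun c _ => ?_
  rw [chainP_range, map_list_prod, List.map_map]
  have h1 := chainP_range K (Ug K L) R (fun t => if h1 : t < i - 1 then 1 else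
    if h2 : t < i - 1 + m then x ⟨t - (i - 1), by omega⟩ else Z c (t - (i - 1) - m))
  have h2 : List.range (R + 1) = List.range (i - 1 + m + (R + 1 - i - m + 1)) := by
    congr 1; omega
  rw [h2, List.range_add, List.range_add, List.map_append, List.map_append, List.prod_append,
    List.prod_append, List.map_map, List.map_map] at h1
  have h3 : ((List.range (i - 1)).map (fun k => slotHom K (Ug K L) R k (if h1 : k < i - 1 then 1 else
    if h2 : k < i - 1 + m then x ⟨k - (i - 1), by omega⟩ else Z c (k - (i - 1) - m)))).prod = 1 := by
    apply List.prod_eq_one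
    intro y hy
    obtain ⟨k, hk, rfl⟩ := List.mem_map.1 hy
    rw [dif_pos (List.mem_range.1 hk), map_one]
  rw [h3, one_mul] at h1
  refine Eq.trans ?_ (h1.trans ?_)
  · congr 1
  · congr 2
    · apply List.map_congr_left
      intro k hk
      have hk := List.mem_range.1 hk
      simp [hk]
    · apply List.map_congr_left
      intro k hk
      have hk := List.mem_range.1 hk
      have e1 : i - 1 + m + k - (i - 1) - m = k := by omega
      have e2 : ¬ (i - 1 + m + k < i - 1) := by omega
      have e3 : ¬ (i - 1 + m + k < i - 1 + m) := by omega
      simp only [Function.comp_apply, e1, e2, e3, dif_neg, not_false_eq_true]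
      rw [hE k (by omega)]

section UEComm

attribute [local instance 100] LieRing.ofAssociativeRing

theorem UE_comm
    (K : Type u) [Field K] (M : Type u) [LieRing M] [LieAlgebra K M]
    {A : Type u} [Ring A] [Algebra K A]
    (G : UniversalEnvelopingAlgebra K M →ₐ[K] A) (a : A)
    (h : ∀ l : M, Commute a (G (UniversalEnvelopingAlgebra.ι K l))) (b) :
    Commute a (G b) := by
  let S : Subalgebra K (UniversalEnvelopingAlgebra K M) := (Subalgebra.centralizer K {a}).comap G
  have hS : ∀ l : M, UniversalEnvelopingAlgebra.ι K l ∈ S := by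
    intro l
    simp only [S, Subalgebra.mem_comap, Subalgebra.mem_centralizer_iff, Set.mem_singleton_iff,
      forall_eq]
    exact h l
  let φ : M →ₗ⁅K⁆ S :=
    { toFun := fun l => ⟨UniversalEnvelopingAlgebra.ι K l, hS l⟩
      map_add' := fun x y => Subtype.ext (map_add _ _ _)
      map_smul' := fun c x => Subtype.ext (map_smul _ _ _)
      map_lie' := fun {x y} => Subtype.ext (LieHom.map_lie _ _ _) }
  have hid : S.val.comp (UniversalEnvelopingAlgebra.lift K φ) = AlgHom.id K _ := by
    apply UniversalEnvelopingAlgebra.hom_ext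
    ext l
    simp [φ]
  have hb : b ∈ S := by
    have := congrArg (fun f => f b) hid
    simp only [AlgHom.comp_apply, AlgHom.id_apply] at this
    rw [← this]
    exact (UniversalEnvelopingAlgebra.lift K φ b).2
  simp only [S, Subalgebra.mem_comap, Subalgebra.mem_centralizer_iff, Set.mem_singleton_iff,
      forall_eq] at hb
  exact hb

end UEComm

/-! ### STATEMENT 18 -/

/-- **Commutation of disjoint insertions (Lemma for the operad `P_{(𝔤,𝔩)}`).**
Let `(𝔤, 𝔩)` be a Lie algebra pair over `K`.  If
`B ∈ (U(𝔤)^{⊗m} ⊗ U(𝔩)⟦ℏ⟧)^𝔩` and `C ∈ (U(𝔤)^{⊗p} ⊗ U(𝔩)⟦ℏ⟧)^𝔩` are `𝔩`-invariant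
and `1 ≤ i`, `i + m ≤ j`, `j + p ≤ r`, then `ι_{i,r}(B)` and `ι_{j,r}(C)` commute in
`U(𝔤)^{⊗(r−1)} ⊗ U(𝔩)⟦ℏ⟧` (inside `U(𝔤)^{⊗r}⟦ℏ⟧`). -/
theorem liePair_disjoint_insertions_commute
    (K : Type u) [Field K] [CharZero K]
    (L : Type u) [LieRing L] [LieAlgebra K L] [Module.Finite K L]
    (𝔩 : LieSubalgebra K L)
    (Δg : Ug K L →ₐ[K] TP K (Ug K L) 2) (hΔg : IsUECoproduct K L Δg)
    (m p i j r : ℕ) (hi : 1 ≤ i) (hij : i + m ≤ j) (hjr : j + p ≤ r)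
    (B : PowerSeries (TP K (Ug K L) (m + 1)))
    (Cc : PowerSeries (TP K (Ug K L) (p + 1)))
    (hB : Memb K L 𝔩 Δg m B) (hC : Memb K L 𝔩 Δg p Cc)
    (ιB : TP K (Ug K L) (m + 1) →ₗ[K] TP K (Ug K L) r)
    (ιC : TP K (Ug K L) (p + 1) →ₗ[K] TP K (Ug K L) r)
    (hιB : IsIotaMap K L 𝔩 Δg m i r ιB)
    (hιC : IsIotaMap K L 𝔩 Δg p j r ιC) :
    PowerSeries.mk (fun d => ιB ((PowerSeries.coeff d) B)) *
        PowerSeries.mk (fun d => ιC ((PowerSeries.coeff d) Cc)) =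
      PowerSeries.mk (fun d => ιC ((PowerSeries.coeff d) Cc)) *
        PowerSeries.mk (fun d => ιB ((PowerSeries.coeff d) B)) := by
  obtain ⟨R, rfl⟩ : ∃ R, r = R + 1 := ⟨r - 1, by omega⟩
  obtain ⟨EB, hEB⟩ := exists_block K (Ug K L) R (R + 1 - i - m) (i - 1 + m) (by omega)
  obtain ⟨EC, hEC⟩ := exists_block K (Ug K L) R (R + 1 - j - p) (j - 1 + p) (by omega)
  have hfB := iota_formula K L 𝔩 Δg m i R hi (by omega) ιB hιB EB hEB
  have hfC := iota_formula K L 𝔩 Δg p j R (by omega) (by omega) ιC hιC EC hEC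
  -- the block of `C` commutes with earlier slots
  have hECs : ∀ t < j - 1 + p, ∀ x z, Commute (EC z) (slotHom K (Ug K L) R t x) := by
    intro t ht x z
    refine comm_of_slots K (Ug K L) _ EC _ ?_ z
    intro k hk y
    rw [hEC k hk]
    exact slotHom_comm K (Ug K L) R _ _ (by omega) (by omega) (by omega) _ _
  obtain ⟨F, hF⟩ := exists_lift K (Ug K L) p
    (fun k => if k < p then slotHom K (Ug K L) R (j - 1 + k)
      else EC.comp (DH K (Ug K L) Δg (R + 1 - j - p))) (by
    intro k l hk hl hkl x y
    by_cases h1 : k < p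
    · by_cases h2 : l < p
      · simp only [h1, h2, if_true]
        exact slotHom_comm K (Ug K L) R _ _ (by omega) (by omega) (by omega) _ _
      · simp only [h1, h2, if_true, if_false]
        exact (hECs _ (by omega) _ _).symm
    · by_cases h2 : l < p
      · simp only [h1, h2, if_true, if_false]
        exact hECs _ (by omega) _ _
      · omega)
  have hF1 : ∀ k < p, ∀ x, F (slotHom K (Ug K L) p k x) = slotHom K (Ug K L) R (j - 1 + k) x := by
    intro k hk x
    rw [hF k hk.le]; simp [hk]
  have hF2 : ∀ x, F (slotHom K (Ug K L) p p x) =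
      EC (DH K (Ug K L) Δg (R + 1 - j - p) x) := by
    intro x
    rw [hF p le_rfl]; simp
  -- `ιC` agrees with the algebra hom `F`
  have hCF : ∀ z ∈ lastSub K L 𝔩 p, ιC z = F z := by
    intro z hz
    refine Submodule.span_induction ?_ (by simp) ?_ ?_ hz
    · rintro _ ⟨x, b, rfl⟩
      rw [hfC]
      have h1 := chainP_range K (Ug K L) p (fun k => if h : k < p then x ⟨k, h⟩ else
        inclUE K L 𝔩 b)
      have h2 : (Fin.snoc x (inclUE K L 𝔩 b) : Fin (p + 1) → Ug K L) =
          fun t : Fin (p + 1) =>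
            (fun k : ℕ => if h : k < p then x ⟨k, h⟩ else inclUE K L 𝔩 b) (t : ℕ) := by
        funext t
        rfl
      rw [h2, h1, map_list_prod, List.map_map, List.range_succ, List.map_append,
        List.prod_append]
      congr 1
      · congr 1
        apply List.map_congr_left
        intro k hk
        have hk := List.mem_range.1 hk
        simp only [Function.comp_apply, hk, dif_pos]
        rw [hF1 k hk]
      · simp [hF2]
    · intro x y _ _ hx hy
      rw [map_add, map_add, hx, hy]
    · intro a x _ hx
      rw [map_smul, map_smul, hx]
  -- `F z` commutes with earlier slots
  have hFs : ∀ t < j - 1, ∀ x z, Commute (F z) (slotHom K (Ug K L) R t x) := by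
    intro t ht x z
    refine comm_of_slots K (Ug K L) _ F _ ?_ z
    intro k hk y
    rcases Nat.lt_or_ge k p with h | h
    · rw [hF1 k h]
      exact slotHom_comm K (Ug K L) R _ _ (by omega) (by omega) (by omega) _ _
    · obtain rfl : k = p := by omega
      rw [hF2]
      exact hECs _ (by omega) _ _
  have hprim : ∀ l : L, ∀ n, DH K (Ug K L) Δg n (UniversalEnvelopingAlgebra.ι K l) =
      ∑ k ∈ Finset.range (n + 1), slotHom K (Ug K L) n k (UniversalEnvelopingAlgebra.ι K l) :=
    fun l n => DH_prim K (Ug K L) Δg _ (hΔg l) n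
  have hC2 : ∀ d, ∀ l : 𝔩, Commute (F (PowerSeries.coeff d Cc))
      (F (DH K (Ug K L) Δg p (UniversalEnvelopingAlgebra.ι K (l : L)))) := by
    intro d l
    have h := congrArg (PowerSeries.coeff d) (hC.2 l)
    rw [PowerSeries.coeff_C_mul, PowerSeries.coeff_mul_C, ← DH_eq] at h
    have hcom : Commute (PowerSeries.coeff d Cc)
      (DH K (Ug K L) Δg p (UniversalEnvelopingAlgebra.ι K (l : L))) := h.symm
    exact hcom.map F
  -- primitive elements
  have hC3 : ∀ d, ∀ l : 𝔩, Commute (F (PowerSeries.coeff d Cc))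
      (EB (DH K (Ug K L) Δg (R + 1 - i - m) (UniversalEnvelopingAlgebra.ι K (l : L)))) := by
    intro d l
    have e1 : EB (DH K (Ug K L) Δg (R + 1 - i - m) (UniversalEnvelopingAlgebra.ι K (l : L))) =
        ∑ k ∈ Finset.range (j - i - m), slotHom K (Ug K L) R (i - 1 + m + k)
          (UniversalEnvelopingAlgebra.ι K (l : L)) +
        F (DH K (Ug K L) Δg p (UniversalEnvelopingAlgebra.ι K (l : L))) := by
      rw [hprim, hprim, map_sum, map_sum, Finset.sum_range_succ _ p, hF2, hprim, map_sum]
      have e2 : R + 1 - i - m + 1 = (j - i - m) + (p + (R + 1 - j - p + 1)) := by omega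
      rw [Finset.sum_congr rfl (fun k hk => hEB k (by
        have := Finset.mem_range.1 hk; omega) _), e2, Finset.sum_range_add, Finset.sum_range_add]
      congr 1
      congr 1
      · refine Finset.sum_congr rfl fun k hk => ?_
        rw [hF1 k (Finset.mem_range.1 hk)]
        congr 2; omega
      · refine Finset.sum_congr rfl fun k hk => ?_
        rw [hEC k (by have := Finset.mem_range.1 hk; omega)]
        congr 2; omega
    rw [e1]
    refine Commute.add_right (Commute.sum_right _ _ _ ?_) (hC2 d l)
    intro k hk
    have := Finset.mem_range.1 hk
    exact hFs _ (by omega) _ _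
  -- all of `U(𝔩)`
  have hC4 : ∀ d, ∀ b : Ul K L 𝔩, Commute (F (PowerSeries.coeff d Cc))
      (EB (DH K (Ug K L) Δg (R + 1 - i - m) (inclUE K L 𝔩 b))) := by
    intro d b
    let G : Ul K L 𝔩 →ₐ[K] TP K (Ug K L) (R + 1) :=
      EB.comp ((DH K (Ug K L) Δg (R + 1 - i - m)).comp (inclUE K L 𝔩))
    exact UE_comm K 𝔩 G _ (by
      intro l
      have : inclUE K L 𝔩 (UniversalEnvelopingAlgebra.ι K l) =
          UniversalEnvelopingAlgebra.ι K (l : L) := by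
        simp [inclUE]
      show Commute _ (EB (DH K (Ug K L) Δg (R + 1 - i - m)
        (inclUE K L 𝔩 (UniversalEnvelopingAlgebra.ι K l))))
      rw [this]
      exact hC3 d l) b
  have hC5 : ∀ d, ∀ z ∈ lastSub K L 𝔩 m, Commute (ιB z) (F (PowerSeries.coeff d Cc)) := by
    intro d z hz
    refine Submodule.span_induction ?_ (by simp) ?_ ?_ hz
    · rintro _ ⟨x, b, rfl⟩
      rw [hfB]
      refine Commute.mul_left ?_ (hC4 d b).symm
      refine Commute.list_prod_left _ _ ?_
      intro y hy
      obtain ⟨k, hk, rfl⟩ := List.mem_map.1 hy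
      have := List.mem_range.1 hk
      exact (hFs _ (by omega) _ _).symm
    · intro x y _ _ hx hy
      rw [map_add]; exact hx.add_left hy
    · intro a x _ hx
      rw [map_smul]; exact hx.smul_left a
  ext d
  rw [PowerSeries.coeff_mul, PowerSeries.coeff_mul, ← Finset.Nat.sum_antidiagonal_swap]
  refine Finset.sum_congr rfl fun k _ => ?_
  simp only [PowerSeries.coeff_mk, Prod.fst_swap, Prod.snd_swap]
  rw [hCF _ (hC.1 _)]
  exact hC5 _ _ (hB.1 _)
end
end

section
/- Let (𝔤, 𝔩) be a Lie algebra pair over K. Set P(n) := (U(𝔤)^{⊗n}⊗U(𝔩)⟦ℏ⟧)^𝔩 for n ≥ 0, and for A ∈ P(n), B ∈ P(m), and 1 ≤ i ≤ n define A∘_i B := ((id^{⊗(i−1)}⊗Δ^{m−1}⊗id^{⊗(n−i)}⊗id)(A)) · ι_{i,n+m}(B), where Δ^{m−1} is applied to the i-th U(𝔤)-factor of A (with the counit ε of U(𝔤) applied in place of Δ^{−1} when m = 0). Then: (i) A∘_i B lies in P(n+m−1), i.e. it is again 𝔩-invariant; (ii) these partial compositions, together with the identity element 1⊗1 ∈ P(1),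 make the family (P(n))_{n≥0} a non-symmetric operad: the sequential axiom (A∘_i B)∘_{i−1+j} C = A∘_i(B∘_j C) holds for A ∈ P(n), B ∈ P(m), C ∈ P(l), 1 ≤ i ≤ n, 1 ≤ j ≤ m, the parallel axiom (A∘_i B)∘_{k−1+m} C = (A∘_k C)∘_i B holds for 1 ≤ i < k ≤ n, and the unitality axiom (1⊗1)∘₁ A = A and A∘_i (1⊗1) = A holds. -/
/-! # Preliminaries: Hopf algebroids in the sense of Xu

We fix a field `K` of characteristic zero, an associative unital `K`-algebra `R` and an
associative unital `K`-algebra `H`.  We construct the `n`-fold tensor powers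
`H^{⊗_K n}` of `H` over `K` and, given source and target maps `α, β : R → H`, the
quotients `H^{⊗_R n}` of `H^{⊗_K n}` by the right ideal `I_n` generated by the elements
`1 ⊗ ⋯ ⊗ β(r) ⊗ 1 ⊗ ⋯ ⊗ 1 − 1 ⊗ ⋯ ⊗ 1 ⊗ α(r) ⊗ ⋯ ⊗ 1`.

A Hopf algebroid is then given by the data `(H, α, β, ·, Δ, ε)` subject to the axioms of
Xu; the iterated coproducts `Δⁿ = (Δ^{n−1} ⊗_R id) ∘ Δ` are part of the data, uniquely
characterized by their recursion.  All axioms involving maps induced on the quotients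
`H^{⊗_R n}` are stated equivalently in terms of (arbitrary) lifts along the quotient
maps and (arbitrary) presentations of elements as sums of pure tensors. -/

noncomputable section

open scoped TensorProduct

universe u

variable (K : Type u) [Field K] [CharZero K]

variable (H : Type u) [Ring H] [Algebra K H]

variable {R : Type u} [Ring R] [Algebra K R]

variable (R)

/-- Inserting a block `b` of length `m + 1` into slot `i` of the pure tensor
`x₀ ⊗ ⋯ ⊗ x_n` (the slot `i` is deleted; it is consumed by the block). -/
def insChain {H : Type u} {n m : ℕ} (i : Fin (n + 1)) (x : Fin (n + 1) → H)
    (b : Fin (m + 1) → H) : Fin (n + (m + 1)) → H := fun j =>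
  if h1 : (j : ℕ) < (i : ℕ) then x ⟨(j : ℕ), by omega⟩
  else if h2 : (j : ℕ) < (i : ℕ) + (m + 1) then b ⟨(j : ℕ) - (i : ℕ), by omega⟩
  else x ⟨(j : ℕ) - m, by have := j.isLt; have := i.isLt; omega⟩
/-! ### Lie algebra pairs and the spaces `(U(𝔤)^{⊗n} ⊗ U(𝔩)⟦ℏ⟧)^𝔩` -/

section LiePair

variable (K : Type u) [Field K] [CharZero K]

variable (L : Type u) [LieRing L] [LieAlgebra K L] [Module.Finite K L]
variable (𝔩 : LieSubalgebra K L)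

attribute [local instance 100] LieRing.ofAssociativeRing

end LiePair
/-! ### STATEMENT 19 -/

/-- The defining clauses of the maps
`id^{⊗(i)} ⊗ Δ^{m−1} ⊗ id^{⊗(n−i)} ⊗ id : U(𝔤)^{⊗(n+1)} ⊗ U(𝔩) → U(𝔤)^{⊗(n+m)} ⊗ U(𝔩)`
(`0`-indexed slot `i`; the counit `ε` is applied in place of `Δ^{−1}` when `m = 0`). -/
def IsSpliceFamily
    (K : Type u) [Field K] [CharZero K]
    (L : Type u) [LieRing L] [LieAlgebra K L] [Module.Finite K L]
    (𝔩 : LieSubalgebra K L)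
    (Δg : Ug K L →ₐ[K] TP K (Ug K L) 2) (εg : Ug K L →ₐ[K] K)
    (sp : ∀ (n m : ℕ), Fin (n + 1) →
      (TP K (Ug K L) (n + 2) →ₗ[K] TP K (Ug K L) (n + m + 1))) : Prop :=
  (∀ (n m : ℕ) (i : Fin (n + 1)) (x : Fin (n + 1) → Ug K L) (b : Ul K L 𝔩)
      (CZ : ℕ) (Z : Fin CZ → Fin (m + 1) → Ug K L),
    (∑ c, chainP K (Ug K L) (m + 1) (Z c)) = DpowG K (Ug K L) Δg.toLinearMap m (x i) →
    sp n (m + 1) i (chainP K (Ug K L) (n + 2) (Fin.snoc x (inclUE K L 𝔩 b))) =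
      ∑ c, chainP K (Ug K L) (n + (m + 1) + 1)
        (Fin.snoc (insChain i x (Z c)) (inclUE K L 𝔩 b))) ∧
  (∀ (n : ℕ) (i : Fin (n + 1)) (x : Fin (n + 1) → Ug K L) (b : Ul K L 𝔩),
    sp n 0 i (chainP K (Ug K L) (n + 2) (Fin.snoc x (inclUE K L 𝔩 b))) =
      εg (x i) •
        chainP K (Ug K L) (n + 1)
          (Fin.snoc (fun j : Fin n =>
            if _ : (j : ℕ) < (i : ℕ) then x ⟨(j : ℕ), by omega⟩
            else x ⟨(j : ℕ) + 1, by omega⟩) (inclUE K L 𝔩 b)))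

section OperadProof

set_option linter.unusedSectionVars false

variable (K : Type u) [Field K] [CharZero K]
variable (L : Type u) [LieRing L] [LieAlgebra K L] [Module.Finite K L]
variable (𝔩 : LieSubalgebra K L)

attribute [local instance 100] LieRing.ofAssociativeRing

/-- `H^{⊗ 1} = H`. -/
def eOne : TP K (Ug K L) (0 + 1) ≃ₐ[K] Ug K L := (AlgEquiv.refl : Ug K L ≃ₐ[K] Ug K L)

/-- `H^{⊗ (n+2)} = H^{⊗ (n+1)} ⊗ H`. -/
def eSucc (n : ℕ) : TP K (Ug K L) (n + 1 + 1) ≃ₐ[K] (TP K (Ug K L) (n + 1)) ⊗[K] (Ug K L) :=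
  (AlgEquiv.refl : (TP K (Ug K L) (n + 1)) ⊗[K] (Ug K L) ≃ₐ[K]
    (TP K (Ug K L) (n + 1)) ⊗[K] (Ug K L))

/-- slot inclusions as algebra maps -/
def slA : (n : ℕ) → ℕ → Ug K L →ₐ[K] TP K (Ug K L) (n + 1)
  | 0, _ => (eOne K L).symm.toAlgHom
  | (n + 1), t => (eSucc K L n).symm.toAlgHom.comp
      (if t = n + 1 then Algebra.TensorProduct.includeRight
       else Algebra.TensorProduct.includeLeft.comp (slA n t))

theorem slA_eq (n t : ℕ) (h : Ug K L) : slA K L n t h = slotP K (Ug K L) (n + 1) t h := by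
  induction n with
  | zero => rfl
  | succ n ih =>
    by_cases ht : t = n + 1
    · simp only [slA, slotP, ht, if_true]; rfl
    · simp only [slA, slotP, ht, if_false, ← ih]; rfl

theorem eSucc_last (n : ℕ) (h : Ug K L) :
    eSucc K L n (slA K L (n + 1) (n + 1) h) = 1 ⊗ₜ[K] h := by
  simp [slA]

theorem eSucc_lt (n t : ℕ) (ht : t ≠ n + 1) (h : Ug K L) :
    eSucc K L n (slA K L (n + 1) t h) = slA K L n t h ⊗ₜ[K] 1 := by
  simp [slA, ht]

/-- generation of `U(𝔤)` -/
theorem ug_mem (M : Type u) [LieRing M] [LieAlgebra K M] (S : Subalgebra K (UniversalEnvelopingAlgebra K M))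
    (hS : ∀ x : M, UniversalEnvelopingAlgebra.ι K x ∈ S) (h : UniversalEnvelopingAlgebra K M) : h ∈ S := by
  let f : M →ₗ⁅K⁆ S :=
    { toFun := fun x => ⟨UniversalEnvelopingAlgebra.ι K x, hS x⟩
      map_add' := fun x y => by ext; simp
      map_smul' := fun c x => by ext; simp
      map_lie' := fun {x y} => by
        ext
        simp [LieRing.of_associative_ring_bracket] }
  have h1 : S.val.comp (UniversalEnvelopingAlgebra.lift K f) = AlgHom.id K _ := by
    apply UniversalEnvelopingAlgebra.hom_ext
    ext x
    simp [f]
  have h2 := congrArg (fun F => F h) h1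
  simp only [AlgHom.comp_apply, AlgHom.id_apply] at h2
  rw [← h2]
  exact (UniversalEnvelopingAlgebra.lift K f h).2

theorem ug_ext {T : Type u} [Ring T] [Algebra K T] (F G : Ug K L →ₐ[K] T)
    (h : ∀ x : L, F (UniversalEnvelopingAlgebra.ι K x) = G (UniversalEnvelopingAlgebra.ι K x))
    (y : Ug K L) : F y = G y :=
  ug_mem K L (AlgHom.equalizer F G) h y

/-- commuting images -/
theorem commute_of_gen {A B T : Type u} [Ring A] [Algebra K A] [Ring B] [Algebra K B]
    [Ring T] [Algebra K T]
    (F : A →ₐ[K] T) (G : B →ₐ[K] T) (s : Set A) (t : Set B)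
    (hs : ∀ S : Subalgebra K A, s ⊆ S → ∀ a, a ∈ S)
    (ht : ∀ S : Subalgebra K B, t ⊆ S → ∀ a, a ∈ S)
    (h : ∀ a ∈ s, ∀ b ∈ t, Commute (F a) (G b)) (a : A) (b : B) : Commute (F a) (G b) := by
  have h1 : ∀ b ∈ t, ∀ a, Commute (F a) (G b) := by
    intro b hb a
    have := hs ((Subalgebra.centralizer K {G b}).comap F) (by
      intro a ha
      simp only [SetLike.mem_coe, Subalgebra.mem_comap, Subalgebra.mem_centralizer_iff,
        Set.mem_singleton_iff, forall_eq]
      exact (h a ha b hb).symm.eq) a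
    simp only [Subalgebra.mem_comap, Subalgebra.mem_centralizer_iff,
        Set.mem_singleton_iff, forall_eq] at this
    exact (show Commute _ _ from this).symm
  have := ht ((Subalgebra.centralizer K {F a}).comap G) (by
      intro b hb
      simp only [SetLike.mem_coe, Subalgebra.mem_comap, Subalgebra.mem_centralizer_iff,
        Set.mem_singleton_iff, forall_eq]
      exact (h1 b hb a).eq) b
  simp only [Subalgebra.mem_comap, Subalgebra.mem_centralizer_iff,
        Set.mem_singleton_iff, forall_eq] at this
  exact this

theorem slA_commute (n s t : ℕ) (hs : s ≤ n) (ht : t ≤ n) (hst : s ≠ t) (g h : Ug K L) :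
    Commute (slA K L n s g) (slA K L n t h) := by
  induction n with
  | zero => omega
  | succ n ih =>
    have key : Commute (eSucc K L n (slA K L (n + 1) s g)) (eSucc K L n (slA K L (n + 1) t h)) := by
      by_cases h1 : s = n + 1
      · subst h1
        rw [eSucc_last, eSucc_lt K L n t (by omega)]
        simp [Commute, SemiconjBy]
      · by_cases h2 : t = n + 1
        · subst h2
          rw [eSucc_last, eSucc_lt K L n s (by omega)]
          simp [Commute, SemiconjBy]
        · rw [eSucc_lt K L n s h1, eSucc_lt K L n t h2]
          have := (ih (by omega) (by omega)).eq
          simp [Commute, SemiconjBy, this]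
    have := key.map (eSucc K L n).symm
    simpa using this

/-- generation of the tensor powers -/
theorem tp_mem' (n : ℕ) (S : Subalgebra K (TP K (Ug K L) (n + 1)))
    (hS : ∀ t ≤ n, ∀ h, slA K L n t h ∈ S) (y) : y ∈ S := by
  induction n with
  | zero => 
    have := hS 0 le_rfl (eOne K L y)
    simpa [slA] using this
  | succ n ih =>
    have key : ∀ z : (TP K (Ug K L) (n + 1)) ⊗[K] (Ug K L), (eSucc K L n).symm z ∈ S := by
      intro z
      induction z using TensorProduct.induction_on with
      | zero => simp
      | add a b ha hb => rw [map_add]; exact S.add_mem ha hb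
      | tmul a b =>
        have h1 : (eSucc K L n).symm (a ⊗ₜ[K] 1) ∈ S := by
          refine ih (S.comap ((eSucc K L n).symm.toAlgHom.comp
            Algebra.TensorProduct.includeLeft)) ?_ a
          intro t ht h
          have := hS t (by omega) h
          rw [← (eSucc K L n).symm_apply_apply (slA K L (n + 1) t h),
            eSucc_lt K L n t (by omega)] at this
          simpa using this
        have h2 : (eSucc K L n).symm (1 ⊗ₜ[K] b) ∈ S := by
          rw [← eSucc_last, AlgEquiv.symm_apply_apply]
          exact hS _ le_rfl _
        have := S.mul_mem h1 h2
        rw [← map_mul] at this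
        simpa using this
    simpa using key (eSucc K L n y)

theorem tp_mem (n : ℕ) (S : Subalgebra K (TP K (Ug K L) (n + 1)))
    (hS : ∀ t ≤ n, ∀ x : L, slA K L n t (UniversalEnvelopingAlgebra.ι K x) ∈ S) (y) : y ∈ S := by
  refine tp_mem' K L n S (fun t ht h => ?_) y
  exact ug_mem K L (S.comap (slA K L n t)) (fun x => hS t ht x) h

theorem tp_ext (n : ℕ) {T : Type u} [Ring T] [Algebra K T]
    (F G : TP K (Ug K L) (n + 1) →ₐ[K] T)
    (h : ∀ t ≤ n, ∀ x : L, F (slA K L n t (UniversalEnvelopingAlgebra.ι K x)) =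
      G (slA K L n t (UniversalEnvelopingAlgebra.ι K x))) (y) : F y = G y :=
  tp_mem K L n (AlgHom.equalizer F G) h y

theorem tp_lift (n : ℕ) {T : Type u} [Ring T] [Algebra K T] (f : ℕ → Ug K L →ₐ[K] T)
    (hf : ∀ s t, s ≠ t → ∀ g h, Commute (f s g) (f t h)) :
    ∃ F : TP K (Ug K L) (n + 1) →ₐ[K] T, ∀ t ≤ n, ∀ h, F (slA K L n t h) = f t h := by
  induction n with
  | zero =>
    refine ⟨(f 0).comp (eOne K L).toAlgHom, ?_⟩
    intro t ht h
    obtain rfl : t = 0 := by omega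
    simp [slA]
  | succ n ih =>
    obtain ⟨F, hF⟩ := ih
    have hc : ∀ x y, Commute (F x) (f (n + 1) y) := by
      intro x y
      have := tp_mem' K L n ((Subalgebra.centralizer K {f (n + 1) y}).comap F) (by
        intro t ht h
        simp only [Subalgebra.mem_comap, Subalgebra.mem_centralizer_iff,
          Set.mem_singleton_iff, forall_eq]
        rw [hF t ht]
        exact (hf _ _ (by omega) _ _).eq) x
      simp only [Subalgebra.mem_comap, Subalgebra.mem_centralizer_iff,
          Set.mem_singleton_iff, forall_eq] at this
      exact (show Commute _ _ from this).symm
    refine ⟨(Algebra.TensorProduct.lift F (f (n + 1)) hc).comp (eSucc K L n).toAlgHom, ?_⟩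
    intro t ht h
    by_cases h1 : t = n + 1
    · subst h1
      simp [eSucc_last]
    · simp [eSucc_lt K L n t h1, hF t (by omega)]

/-- the primitive map -/
def primHom (b : ℕ) (s : Finset ℕ) (hs : ∀ t ∈ s, t ≤ b) : L →ₗ⁅K⁆ TP K (Ug K L) (b + 1) :=
  { toFun := fun x => ∑ t ∈ s, slA K L b t (UniversalEnvelopingAlgebra.ι K x)
    map_add' := fun x y => by simp [Finset.sum_add_distrib]
    map_smul' := fun c x => by simp [Finset.smul_sum]
    map_lie' := fun {x y} => by
      simp only [LieRing.of_associative_ring_bracket, Finset.sum_mul_sum, LieHom.map_lie, map_sub,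
        map_mul]
      rw [Finset.sum_comm (s := s) (t := s) (f := fun i j => slA K L b i ((UniversalEnvelopingAlgebra.ι K) y) * slA K L b j ((UniversalEnvelopingAlgebra.ι K) x)),
        ← Finset.sum_sub_distrib]
      refine Finset.sum_congr rfl fun i hi => ?_
      rw [← Finset.sum_sub_distrib, Finset.sum_eq_single i]
      · intro j hj hji
        rw [(slA_commute K L b i j (hs i hi) (hs j hj) hji.symm _ _).eq, sub_self]
      · intro h; exact absurd hi h }

theorem exists_slotMap (a b : ℕ) (ψ : ℕ → ℕ) :
    ∃ F : TP K (Ug K L) (a + 1) →ₐ[K] TP K (Ug K L) (b + 1), ∀ t ≤ a, ∀ x : L,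
      F (slA K L a t (UniversalEnvelopingAlgebra.ι K x)) =
        ∑ s ∈ (Finset.range (b + 1)).filter (fun s => ψ s = t),
          slA K L b s (UniversalEnvelopingAlgebra.ι K x) := by
  have hs : ∀ t, ∀ s ∈ (Finset.range (b + 1)).filter (fun s => ψ s = t), s ≤ b := by
    intro t s hs
    simp at hs; omega
  obtain ⟨F, hF⟩ := tp_lift K L a
    (fun t => UniversalEnvelopingAlgebra.lift K (primHom K L b _ (hs t))) (by
      intro s t hst g h
      refine commute_of_gen K _ _ (Set.range (UniversalEnvelopingAlgebra.ι K))
        (Set.range (UniversalEnvelopingAlgebra.ι K)) ?_ ?_ ?_ g h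
      · intro S hS a; exact ug_mem K L S (fun x => hS ⟨x, rfl⟩) a
      · intro S hS a; exact ug_mem K L S (fun x => hS ⟨x, rfl⟩) a
      · rintro _ ⟨x, rfl⟩ _ ⟨y, rfl⟩
        simp only [UniversalEnvelopingAlgebra.lift_ι_apply]
        change Commute (∑ i ∈ (Finset.range (b + 1)).filter (fun r => ψ r = s),
            slA K L b i (UniversalEnvelopingAlgebra.ι K x))
          (∑ i ∈ (Finset.range (b + 1)).filter (fun r => ψ r = t),
            slA K L b i (UniversalEnvelopingAlgebra.ι K y))
        refine Commute.sum_left _ _ _ fun i hi => Commute.sum_right _ _ _ fun j hj => ?_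
        simp only [Finset.mem_filter, Finset.mem_range] at hi hj
        exact slA_commute K L b i j (by omega) (by omega) (by rintro rfl; omega) _ _)
  refine ⟨F, fun t ht x => ?_⟩
  rw [hF t ht]
  simp only [UniversalEnvelopingAlgebra.lift_ι_apply]
  rfl

/-- the slot map -/
def SM (a b : ℕ) (ψ : ℕ → ℕ) : TP K (Ug K L) (a + 1) →ₐ[K] TP K (Ug K L) (b + 1) :=
  (exists_slotMap K L a b ψ).choose

theorem SM_ι (a b : ℕ) (ψ : ℕ → ℕ) (t : ℕ) (ht : t ≤ a) (x : L) :
    SM K L a b ψ (slA K L a t (UniversalEnvelopingAlgebra.ι K x)) =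
        ∑ s ∈ (Finset.range (b + 1)).filter (fun s => ψ s = t),
          slA K L b s (UniversalEnvelopingAlgebra.ι K x) :=
  (exists_slotMap K L a b ψ).choose_spec t ht x

theorem SM_comp (a b c : ℕ) (ψ χ ρ : ℕ → ℕ)
    (h : ∀ r ≤ c, ∀ t ≤ a, ρ r = t ↔ χ r ≤ b ∧ ψ (χ r) = t) (y) :
    SM K L b c χ (SM K L a b ψ y) = SM K L a c ρ y := by
  refine tp_ext K L a ((SM K L b c χ).comp (SM K L a b ψ)) _ ?_ y
  intro t ht x
  simp only [AlgHom.comp_apply]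
  rw [SM_ι K L _ _ _ _ ht, SM_ι K L _ _ _ _ ht, map_sum]
  have : ∀ s ∈ (Finset.range (b + 1)).filter (fun s => ψ s = t),
      SM K L b c χ (slA K L b s (UniversalEnvelopingAlgebra.ι K x)) =
      ∑ r ∈ ((Finset.range (c + 1)).filter (fun r => ρ r = t)).filter (fun r => χ r = s),
        slA K L c r (UniversalEnvelopingAlgebra.ι K x) := by
    intro s hs
    simp only [Finset.mem_filter, Finset.mem_range] at hs
    rw [SM_ι K L _ _ _ _ (by omega)]
    refine Finset.sum_congr ?_ fun _ _ => rfl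
    ext r
    simp only [Finset.mem_filter, Finset.mem_range]
    constructor
    · rintro ⟨h1, rfl⟩
      exact ⟨⟨h1, (h r (by omega) t ht).2 ⟨by omega, hs.2⟩⟩, rfl⟩
    · rintro ⟨⟨h1, _⟩, h2⟩
      exact ⟨h1, h2⟩
  rw [Finset.sum_congr rfl this]
  refine Finset.sum_fiberwise_of_maps_to ?_ _
  intro r hr
  simp only [Finset.mem_filter, Finset.mem_range] at hr ⊢
  have := (h r (by omega) t ht).1 hr.2
  exact ⟨by omega, this.2⟩

theorem SM_congr (a b : ℕ) (ψ ρ : ℕ → ℕ)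
    (h : ∀ r ≤ b, ∀ t ≤ a, ρ r = t ↔ ψ r = t) (y) :
    SM K L a b ψ y = SM K L a b ρ y := by
  refine tp_ext K L a _ _ ?_ y
  intro t ht x
  rw [SM_ι K L _ _ _ _ ht, SM_ι K L _ _ _ _ ht]
  refine Finset.sum_congr ?_ fun _ _ => rfl
  ext r
  simp only [Finset.mem_filter, Finset.mem_range]
  constructor
  · rintro ⟨h1, h2⟩; exact ⟨h1, (h r (by omega) t ht).2 h2⟩
  · rintro ⟨h1, h2⟩; exact ⟨h1, (h r (by omega) t ht).1 h2⟩

theorem SM_single (a b : ℕ) (ψ : ℕ → ℕ) (t s : ℕ) (ht : t ≤ a) (hs : s ≤ b)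
    (h : ∀ r ≤ b, ψ r = t ↔ r = s) (g : Ug K L) :
    SM K L a b ψ (slA K L a t g) = slA K L b s g := by
  refine ug_ext K L ((SM K L a b ψ).comp (slA K L a t)) (slA K L b s) ?_ g
  intro x
  simp only [AlgHom.comp_apply]
  rw [SM_ι K L _ _ _ _ ht, Finset.sum_eq_single s]
  · intro r hr hrs
    simp only [Finset.mem_filter, Finset.mem_range] at hr
    exact absurd ((h r (by omega)).1 hr.2) hrs
  · intro hh
    simp only [Finset.mem_filter, Finset.mem_range] at hh
    exact absurd ⟨by omega, (h s hs).2 rfl⟩ hh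

theorem SM_empty (εg : Ug K L →ₐ[K] K) (hεg : IsUECounit K L εg)
    (a b : ℕ) (ψ : ℕ → ℕ) (t : ℕ) (ht : t ≤ a)
    (h : ∀ r ≤ b, ψ r ≠ t) (g : Ug K L) :
    SM K L a b ψ (slA K L a t g) = εg g • 1 := by
  have := ug_ext K L ((SM K L a b ψ).comp (slA K L a t)) ((Algebra.ofId K _).comp εg) ?_ g
  · simpa [Algebra.ofId_apply, Algebra.algebraMap_eq_smul_one] using this
  intro x
  simp only [AlgHom.comp_apply]
  rw [SM_ι K L _ _ _ _ ht, hεg x, map_zero]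
  refine Finset.sum_eq_zero fun r hr => ?_
  simp only [Finset.mem_filter, Finset.mem_range] at hr
  exact absurd hr.2 (h r (by omega))

theorem SM_id (a : ℕ) (ψ : ℕ → ℕ) (h : ∀ r ≤ a, ψ r = r) (y) : SM K L a a ψ y = y := by
  refine tp_ext K L a _ (AlgHom.id K _) ?_ y
  intro t ht x
  rw [SM_single K L a a ψ t t ht ht]
  · rfl
  · intro r hr; rw [h r hr]

theorem DpowG_eq (Δg : Ug K L →ₐ[K] TP K (Ug K L) 2) (hΔg : IsUECoproduct K L Δg) (n : ℕ)
    (h : Ug K L) :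
    DpowG K (Ug K L) Δg.toLinearMap n h = SM K L 0 n (fun _ => 0) (slA K L 0 0 h) := by
  induction n generalizing h with
  | zero => 
    rw [SM_single K L 0 0 _ 0 0 le_rfl le_rfl (by intro r hr; simp; omega)]
    rfl
  | succ n ih =>
    let G : Ug K L →ₐ[K] (TP K (Ug K L) (n + 1)) :=
      (SM K L 0 n (fun _ => 0)).comp (slA K L 0 0)
    have hG : DpowG K (Ug K L) Δg.toLinearMap n = G.toLinearMap := by
      ext y; exact ih y
    let Δ' : Ug K L →ₐ[K] (Ug K L ⊗[K] Ug K L) := Δg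
    have h1 : DpowG K (Ug K L) Δg.toLinearMap (n + 1) h =
        (eSucc K L n).symm (Algebra.TensorProduct.map G (AlgHom.id K _) (Δ' h)) := by
      have : DpowG K (Ug K L) Δg.toLinearMap (n + 1) h =
        (eSucc K L n).symm (LinearMap.rTensor _ (DpowG K (Ug K L) Δg.toLinearMap n) (Δ' h)) := rfl
      rw [this, hG]
      rfl
    rw [h1]
    refine ug_ext K L (((eSucc K L n).symm.toAlgHom.comp
      (Algebra.TensorProduct.map G (AlgHom.id K _))).comp Δ')
      ((SM K L 0 (n + 1) (fun _ => 0)).comp (slA K L 0 0)) ?_ h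
    intro x
    have hx : Δ' (UniversalEnvelopingAlgebra.ι K x) = 
      (UniversalEnvelopingAlgebra.ι K x) ⊗ₜ[K] 1 + 1 ⊗ₜ[K] (UniversalEnvelopingAlgebra.ι K x) :=
      hΔg x
    simp only [AlgHom.comp_apply]
    rw [hx, map_add, Algebra.TensorProduct.map_tmul, Algebra.TensorProduct.map_tmul]
    apply (eSucc K L n).injective
    simp only [G, AlgHom.comp_apply]
    rw [SM_ι K L _ _ _ _ le_rfl, SM_ι K L _ _ _ _ le_rfl]
    simp only [Finset.filter_true]
    rw [Finset.sum_range_succ (n := n + 1), map_add (eSucc K L n) (∑ t ∈ Finset.range (n + 1), _),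
      eSucc_last, map_sum]
    have : ∀ t ∈ Finset.range (n + 1), 
        eSucc K L n (slA K L (n + 1) t (UniversalEnvelopingAlgebra.ι K x)) =
        slA K L n t (UniversalEnvelopingAlgebra.ι K x) ⊗ₜ[K] 1 := by
      intro t ht
      simp only [Finset.mem_range] at ht
      exact eSucc_lt K L n t (by omega) _
    rw [Finset.sum_congr rfl this]
    simp [TensorProduct.sum_tmul]

/-- ordered product of `f 0, …, f (n-1)` -/
def pN {T : Type u} [Ring T] (f : ℕ → T) : ℕ → T
  | 0 => 1
  | (n + 1) => pN f n * f n

theorem pN_congr {T : Type u} [Ring T] (f g : ℕ → T) (n : ℕ) (h : ∀ t < n, f t = g t) :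
    pN f n = pN g n := by
  induction n with
  | zero => rfl
  | succ n ih => rw [pN, pN, ih (fun t ht => h t (by omega)), h n (by omega)]

theorem pN_one {T : Type u} [Ring T] (f : ℕ → T) (n : ℕ) (h : ∀ t < n, f t = 1) :
    pN f n = 1 := by
  induction n with
  | zero => rfl
  | succ n ih => rw [pN, ih (fun t ht => h t (by omega)), h n (by omega), one_mul]

theorem pN_add {T : Type u} [Ring T] (f : ℕ → T) (a b : ℕ) :
    pN f (a + b) = pN f a * pN (fun t => f (a + t)) b := by
  induction b with
  | zero => simp [pN]
  | succ n ih => rw [← add_assoc, pN, pN, ih, mul_assoc]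

theorem pN_split {T : Type u} [Ring T] (f : ℕ → T) (N a b c : ℕ) (h : N = a + (b + c)) :
    pN f N = pN f a * (pN (fun t => f (a + t)) b * pN (fun t => f (a + (b + t))) c) := by
  rw [h, pN_add, pN_add]

theorem pN_map {T T' : Type u} [Ring T] [Ring T'] [Algebra K T] [Algebra K T'] (F : T →ₐ[K] T')
    (f : ℕ → T) (n : ℕ) : F (pN f n) = pN (fun t => F (f t)) n := by
  induction n with
  | zero => simp [pN]
  | succ n ih => rw [pN, pN, map_mul, ih]

theorem pN_commute {T : Type u} [Ring T] (f : ℕ → T) (n : ℕ) (y : T)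
    (h : ∀ t < n, Commute (f t) y) : Commute (pN f n) y := by
  induction n with
  | zero => exact Commute.one_left _
  | succ n ih => exact (ih (fun t ht => h t (by omega))).mul_left (h n (by omega))

theorem pN_mul {T : Type u} [Ring T] (f g : ℕ → T) (n : ℕ)
    (h : ∀ s < n, ∀ t < n, s ≠ t → Commute (f s) (g t)) :
    pN f n * pN g n = pN (fun t => f t * g t) n := by
  induction n with
  | zero => simp [pN]
  | succ n ih =>
    have h1 : Commute (pN g n) (f n) :=
      pN_commute _ _ _ (fun t ht => (h n (by omega) t (by omega) (by omega)).symm)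
    rw [pN, pN, pN, ← ih (fun s hs t ht => h s (by omega) t (by omega)), mul_assoc,
      ← mul_assoc (f n), ← h1.eq]
    simp only [mul_assoc]

theorem pN_single {T : Type u} [Ring T] (f : ℕ → T) (n t : ℕ) (ht : t < n)
    (h : ∀ s < n, s ≠ t → f s = 1) : pN f n = f t := by
  obtain ⟨k, rfl⟩ : ∃ k, n = t + (1 + k) := ⟨n - t - 1, by omega⟩
  rw [pN_add, pN_add, pN_one f t (fun s hs => h s (by omega) (by omega)),
    pN_one _ k (fun s hs => h _ (by omega) (by omega))]
  simp [pN]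

theorem ofFn_pN {T : Type u} [Ring T] (f : ℕ → T) (n : ℕ) :
    (List.ofFn (fun i : Fin n => f i)).prod = pN f n := by
  induction n with
  | zero => simp [pN]
  | succ n ih =>
    rw [List.ofFn_succ']
    simp [pN, ih]

theorem chain_eq (n : ℕ) (x : Fin (n + 1) → Ug K L) (X : ℕ → Ug K L)
    (h : ∀ t : Fin (n + 1), x t = X t) :
    chainP K (Ug K L) (n + 1) x = pN (fun t => slA K L n t (X t)) (n + 1) := by
  rw [chainP, ← ofFn_pN]
  congr 2
  funext i
  rw [slA_eq, h]

/-- extension of a finite sequence by `1` -/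
def ext1 {N : ℕ} (x : Fin N → Ug K L) (t : ℕ) : Ug K L := if h : t < N then x ⟨t, h⟩ else 1

theorem ext1_apply {N : ℕ} (x : Fin N → Ug K L) (t : Fin N) : x t = ext1 K L x t := by
  simp [ext1]

theorem ext1_lt {N : ℕ} (x : Fin N → Ug K L) (t : ℕ) (h : t < N) : ext1 K L x t = x ⟨t, h⟩ := by
  simp [ext1, h]

theorem exists_pres (n : ℕ) (y : TP K (Ug K L) (n + 1)) :
    ∃ (CZ : ℕ) (Z : Fin CZ → Fin (n + 1) → Ug K L),
      (∑ c, chainP K (Ug K L) (n + 1) (Z c)) = y := by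
  have key : y ∈ AddSubmonoid.closure (Set.range (fun X : ℕ → Ug K L =>
      pN (fun t => slA K L n t (X t)) (n + 1))) := by
    induction n with
    | zero =>
      apply AddSubmonoid.subset_closure
      refine ⟨fun _ => eOne K L y, ?_⟩
      simp [pN, slA]
    | succ n ih =>
      have key : ∀ z : (TP K (Ug K L) (n + 1)) ⊗[K] (Ug K L), (eSucc K L n).symm z ∈
          AddSubmonoid.closure (Set.range (fun X : ℕ → Ug K L =>
      pN (fun t => slA K L (n + 1) t (X t)) (n + 1 + 1))) := by
        intro z
        induction z using TensorProduct.induction_on with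
        | zero => simp
        | add a b ha hb => rw [map_add]; exact AddSubmonoid.add_mem _ ha hb
        | tmul a b =>
          have ha := ih a
          induction ha using AddSubmonoid.closure_induction with
          | zero => simp
          | add a a' _ _ h1 h2 => rw [TensorProduct.add_tmul, map_add]; exact AddSubmonoid.add_mem _ h1 h2
          | mem a ha =>
            obtain ⟨X, rfl⟩ := ha
            apply AddSubmonoid.subset_closure
            refine ⟨fun t => if t = n + 1 then b else X t, ?_⟩
            apply (eSucc K L n).injective
            dsimp only
            rw [pN, map_mul, AlgEquiv.apply_symm_apply, if_pos rfl, eSucc_last]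
            have h1 := pN_map K ((eSucc K L n).toAlgHom) (fun t => slA K L (n + 1) t
                (if t = n + 1 then b else X t)) (n + 1)
            have h2 := pN_map K (Algebra.TensorProduct.includeLeft :
              TP K (Ug K L) (n + 1) →ₐ[K] TP K (Ug K L) (n + 1) ⊗[K] Ug K L)
              (fun t => slA K L n t (X t)) (n + 1)
            have h3 : eSucc K L n (pN (fun t => slA K L (n + 1) t
                (if t = n + 1 then b else X t)) (n + 1)) =
                (pN (fun t => slA K L n t (X t)) (n + 1)) ⊗ₜ[K] 1 := by
              refine h1.trans (Eq.trans ?_ h2.symm)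
              refine pN_congr _ _ _ fun t ht => ?_
              have := eSucc_lt K L n t (by omega) (X t)
              rw [if_neg (by omega)]
              exact this
            rw [h3]
            simp
      simpa using key (eSucc K L n y)
  obtain ⟨l, hl, rfl⟩ := AddSubmonoid.exists_list_of_mem_closure key
  have : ∀ c : Fin l.length, ∃ X : ℕ → Ug K L,
      pN (fun t => slA K L n t (X t)) (n + 1) = l[c] := fun c => hl _ (List.getElem_mem _)
  choose X hX using this
  refine ⟨l.length, fun c t => X c t, ?_⟩
  have h2 : ∀ c : Fin l.length, chainP K (Ug K L) (n + 1) (fun t : Fin (n + 1) => X c t) = l[c] := by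
    intro c
    rw [chain_eq K L n _ (X c) (fun _ => rfl), hX]
  simp only [h2]
  simp

/-- slot function of the splice maps -/
def spF (i m : ℕ) (s : ℕ) : ℕ := if s < i then s else if s < i + m then i else s + 1 - m

/-- slot function of the iota maps -/
def ioF (i m : ℕ) (s : ℕ) : ℕ := if s < i then m + 1 else if s < i + m then s - i else m

/-- slot function of the embedding of a block of length `m + 1` in position `i` -/
def emF (i m : ℕ) (s : ℕ) : ℕ := if s < i then m + 1 else if s ≤ i + m then s - i else m + 1

theorem em_chain (i m N : ℕ) (h : i + m ≤ N) (z : Fin (m + 1) → Ug K L) :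
    SM K L m N (emF i m) (chainP K (Ug K L) (m + 1) z) =
      pN (fun t => slA K L N (i + t) (ext1 K L z t)) (m + 1) := by
  rw [chain_eq K L m z _ (ext1_apply K L z), pN_map]
  refine pN_congr _ _ _ fun t ht => ?_
  refine SM_single K L m N _ t (i + t) (by omega) (by omega) ?_ _
  intro r hr
  unfold emF; split_ifs <;> omega

theorem SM_block (Δg : Ug K L →ₐ[K] TP K (Ug K L) 2) (hΔg : IsUECoproduct K L Δg)
    (a N i m : ℕ) (ψ : ℕ → ℕ) (t : ℕ) (ht : t ≤ a) (h : i + m ≤ N)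
    (hψ : ∀ r ≤ N, ψ r = t ↔ i ≤ r ∧ r ≤ i + m) (g : Ug K L) :
    SM K L a N ψ (slA K L a t g) =
      SM K L m N (emF i m) (DpowG K (Ug K L) Δg.toLinearMap m g) := by
  rw [DpowG_eq K L Δg hΔg, SM_comp K L 0 m N _ _ (fun r => if i ≤ r ∧ r ≤ i + m then 0 else 1)]
  · refine ug_ext K L ((SM K L a N ψ).comp (slA K L a t))
      ((SM K L 0 N (fun r => if i ≤ r ∧ r ≤ i + m then 0 else 1)).comp (slA K L 0 0)) ?_ g
    intro x
    simp only [AlgHom.comp_apply]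
    rw [SM_ι K L _ _ _ _ ht, SM_ι K L _ _ _ _ le_rfl]
    refine Finset.sum_congr ?_ fun _ _ => rfl
    ext r
    simp only [Finset.mem_filter, Finset.mem_range]
    constructor
    · rintro ⟨h1, h2⟩; exact ⟨h1, if_pos ((hψ r (by omega)).1 h2)⟩
    · rintro ⟨h1, h2⟩; refine ⟨h1, (hψ r (by omega)).2 ?_⟩
      by_contra h3; rw [if_neg h3] at h2; omega
  · intro r hr t ht
    unfold emF; split_ifs <;> omega

theorem lastSub_ind {T : Type u} [AddCommGroup T] [Module K T] (n : ℕ)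
    (F G : TP K (Ug K L) (n + 1) →ₗ[K] T)
    (h : ∀ (x : Fin n → Ug K L) (b : Ul K L 𝔩),
      F (chainP K (Ug K L) (n + 1) (Fin.snoc x (inclUE K L 𝔩 b))) =
      G (chainP K (Ug K L) (n + 1) (Fin.snoc x (inclUE K L 𝔩 b))))
    (y) (hy : y ∈ lastSub K L 𝔩 n) : F y = G y := by
  have : lastSub K L 𝔩 n ≤ LinearMap.eqLocus F G := by
    rw [lastSub, Submodule.span_le]
    rintro _ ⟨x, b, rfl⟩
    exact h x b
  exact this hy

/-- `snoc` on natural numbers -/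
theorem ext1_snoc_lt {n : ℕ} (x : Fin n → Ug K L) (b : Ug K L) (t : ℕ) (h : t < n) :
    ext1 K L (Fin.snoc x b : Fin (n + 1) → Ug K L) t = x ⟨t, h⟩ := by
  rw [ext1_lt K L _ t (by omega)]
  exact Fin.snoc_castSucc (α := fun _ => Ug K L) b x ⟨t, h⟩

theorem ext1_snoc_last {n : ℕ} (x : Fin n → Ug K L) (b : Ug K L) :
    ext1 K L (Fin.snoc x b : Fin (n + 1) → Ug K L) n = b := by
  rw [ext1_lt K L _ n (by omega)]
  exact Fin.snoc_last (α := fun _ => Ug K L) b x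

theorem sp_eq_succ (Δg : Ug K L →ₐ[K] TP K (Ug K L) 2) (hΔg : IsUECoproduct K L Δg)
    (εg : Ug K L →ₐ[K] K)
    (sp : ∀ (n m : ℕ), Fin (n + 1) →
      (TP K (Ug K L) (n + 2) →ₗ[K] TP K (Ug K L) (n + m + 1)))
    (hsp : IsSpliceFamily K L 𝔩 Δg εg sp) (n m : ℕ) (i : Fin (n + 1))
    (y : TP K (Ug K L) (n + 2)) (hy : y ∈ lastSub K L 𝔩 (n + 1)) :
    sp n (m + 1) i y = SM K L (n + 1) (n + (m + 1)) (spF i (m + 1)) y := by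
  refine lastSub_ind K L 𝔩 (n + 1) (sp n (m + 1) i)
    (SM K L (n + 1) (n + (m + 1)) (spF i (m + 1))).toLinearMap ?_ y hy
  intro x b
  have hi := i.isLt
  obtain ⟨CZ, Z, hZ⟩ := exists_pres K L m (DpowG K (Ug K L) Δg.toLinearMap m (x i))
  refine (hsp.1 n m i x b CZ Z hZ).trans ?_
  rw [AlgHom.toLinearMap_apply, chain_eq K L (n + 1) _ _ (ext1_apply K L _), pN_map]
  set X := ext1 K L (Fin.snoc x (inclUE K L 𝔩 b) : Fin (n + 1 + 1) → Ug K L) with hX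
  have e1 : n + 1 + 1 = (i : ℕ) + (1 + (n + 1 - i)) := by omega
  have e2 : n + (m + 1) + 1 = (i : ℕ) + ((m + 1) + (n + 1 - i)) := by omega
  rw [pN_split _ _ _ _ _ e1]
  have q1 : pN (fun t => SM K L (n + 1) (n + (m + 1)) (spF i (m + 1)) (slA K L (n + 1) t (X t))) i =
      pN (fun t => slA K L (n + (m + 1)) t (X t)) i := by
    refine pN_congr _ _ _ fun t ht => ?_
    refine SM_single K L _ _ _ t t (by omega) (by omega) ?_ _
    intro r hr; unfold spF; split_ifs <;> omega
  have q2 : X i = x i := ext1_snoc_lt K L x _ i hi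
  have q3 : SM K L (n + 1) (n + (m + 1)) (spF i (m + 1)) (slA K L (n + 1) i (X i)) =
      ∑ c, pN (fun t => slA K L (n + (m + 1)) (i + t) (ext1 K L (Z c) t)) (m + 1) := by
    rw [SM_block K L Δg hΔg (n + 1) (n + (m + 1)) i m _ i (by omega) (by omega), q2, ← hZ, map_sum]
    · refine Finset.sum_congr rfl fun c _ => ?_
      exact em_chain K L i m _ (by omega) _
    · intro r hr; unfold spF; split_ifs <;> omega
  have q4 : pN (fun t => SM K L (n + 1) (n + (m + 1)) (spF i (m + 1))
        (slA K L (n + 1) (i + (1 + t)) (X (i + (1 + t))))) (n + 1 - i) =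
      pN (fun t => slA K L (n + (m + 1)) (i + ((m + 1) + t)) (X (i + (1 + t)))) (n + 1 - i) := by
    refine pN_congr _ _ _ fun t ht => ?_
    refine SM_single K L _ _ _ _ _ (by omega) (by omega) ?_ _
    intro r hr; unfold spF; split_ifs <;> omega
  rw [q1, q4]
  simp only [pN, one_mul, add_zero]
  rw [q3, Finset.sum_mul, Finset.mul_sum]
  refine Finset.sum_congr rfl fun c _ => ?_
  rw [chain_eq K L (n + (m + 1)) _ _ (ext1_apply K L _), pN_split _ _ _ _ _ e2]
  congr 1
  · refine pN_congr _ _ _ fun t ht => ?_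
    rw [ext1_snoc_lt K L _ _ _ (by omega), hX, ext1_snoc_lt K L _ _ _ (by omega)]
    simp [insChain, ht]
  congr 1
  · refine pN_congr _ _ _ fun t ht => ?_
    rw [ext1_snoc_lt K L _ _ _ (by omega), ext1_lt K L _ _ ht]
    simp [insChain, ht]
  · refine pN_congr _ _ _ fun t ht => ?_
    by_cases h : i + (1 + t) = n + 1
    · have h' : i + ((m + 1) + t) = n + (m + 1) := by omega
      rw [h, h', ext1_snoc_last, hX, ext1_snoc_last]
    · rw [ext1_snoc_lt K L _ _ _ (by omega), hX, ext1_snoc_lt K L _ _ _ (by omega)]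
      simp only [insChain]
      rw [dif_neg (by omega), dif_neg (by omega)]
      congr 3
      omega

theorem sp_eq_zero (Δg : Ug K L →ₐ[K] TP K (Ug K L) 2)
    (εg : Ug K L →ₐ[K] K) (hεg : IsUECounit K L εg)
    (sp : ∀ (n m : ℕ), Fin (n + 1) →
      (TP K (Ug K L) (n + 2) →ₗ[K] TP K (Ug K L) (n + m + 1)))
    (hsp : IsSpliceFamily K L 𝔩 Δg εg sp) (n : ℕ) (i : Fin (n + 1))
    (y : TP K (Ug K L) (n + 2)) (hy : y ∈ lastSub K L 𝔩 (n + 1)) :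
    sp n 0 i y = SM K L (n + 1) (n + 0) (spF i 0) y := by
  refine lastSub_ind K L 𝔩 (n + 1) (sp n 0 i)
    (SM K L (n + 1) (n + 0) (spF i 0)).toLinearMap ?_ y hy
  intro x b
  have hi := i.isLt
  refine (hsp.2 n i x b).trans ?_
  rw [AlgHom.toLinearMap_apply, chain_eq K L (n + 1) _ _ (ext1_apply K L _), pN_map]
  set X := ext1 K L (Fin.snoc x (inclUE K L 𝔩 b) : Fin (n + 1 + 1) → Ug K L) with hX
  have e1 : n + 1 + 1 = (i : ℕ) + (1 + (n + 1 - i)) := by omega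
  have e2 : n + 1 = (i : ℕ) + (n + 1 - i) := by omega
  rw [pN_split _ _ _ _ _ e1]
  have q1 : pN (fun t => SM K L (n + 1) (n + 0) (spF i 0) (slA K L (n + 1) t (X t))) i =
      pN (fun t => slA K L (n + 0) t (X t)) i := by
    refine pN_congr _ _ _ fun t ht => ?_
    refine SM_single K L _ _ _ t t (by omega) (by omega) ?_ _
    intro r hr; unfold spF; split_ifs <;> omega
  have q2 : X i = x i := ext1_snoc_lt K L x _ i hi
  have q3 : SM K L (n + 1) (n + 0) (spF i 0) (slA K L (n + 1) i (X i)) = εg (x i) • 1 := by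
    rw [SM_empty K L εg hεg _ _ _ _ (by omega), q2]
    intro r hr; unfold spF; split_ifs <;> omega
  have q4 : pN (fun t => SM K L (n + 1) (n + 0) (spF i 0)
        (slA K L (n + 1) (i + (1 + t)) (X (i + (1 + t))))) (n + 1 - i) =
      pN (fun t => slA K L (n + 0) (i + t) (X (i + (1 + t)))) (n + 1 - i) := by
    refine pN_congr _ _ _ fun t ht => ?_
    refine SM_single K L _ _ _ _ _ (by omega) (by omega) ?_ _
    intro r hr; unfold spF; split_ifs <;> omega
  rw [q1, q4]
  simp only [pN, one_mul, add_zero]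
  rw [q3, smul_mul_assoc, one_mul, mul_smul_comm]
  congr 1
  rw [chain_eq K L n _ _ (ext1_apply K L _)]
  have e3 : pN (fun t => slA K L n t (ext1 K L (Fin.snoc (fun j : Fin n =>
            if _ : (j : ℕ) < (i : ℕ) then x ⟨(j : ℕ), by omega⟩
            else x ⟨(j : ℕ) + 1, by omega⟩) (inclUE K L 𝔩 b) : Fin (n + 1) → Ug K L) t)) (n + 1) = _ :=
    (congrArg _ e2).trans (pN_add _ _ _)
  refine e3.trans ?_
  congr 1
  · refine pN_congr _ _ _ fun t ht => ?_
    rw [ext1_snoc_lt K L _ _ _ (by omega), hX, ext1_snoc_lt K L _ _ _ (by omega)]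
    simp [ht]
  · refine pN_congr _ _ _ fun t ht => ?_
    by_cases h : i + (1 + t) = n + 1
    · have h' : i + t = n := by omega
      rw [h, h', ext1_snoc_last, hX, ext1_snoc_last]
      rfl
    · rw [ext1_snoc_lt K L _ _ _ (by omega), hX, ext1_snoc_lt K L _ _ _ (by omega)]
      rw [dif_neg (by simp)]
      congr 3
      simp only []
      omega

theorem sp_eq (Δg : Ug K L →ₐ[K] TP K (Ug K L) 2) (hΔg : IsUECoproduct K L Δg)
    (εg : Ug K L →ₐ[K] K) (hεg : IsUECounit K L εg)
    (sp : ∀ (n m : ℕ), Fin (n + 1) →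
      (TP K (Ug K L) (n + 2) →ₗ[K] TP K (Ug K L) (n + m + 1)))
    (hsp : IsSpliceFamily K L 𝔩 Δg εg sp) (n m : ℕ) (i : Fin (n + 1))
    (y : TP K (Ug K L) (n + 2)) (hy : y ∈ lastSub K L 𝔩 (n + 1)) :
    sp n m i y = SM K L (n + 1) (n + m) (spF i m) y := by
  cases m with
  | zero => exact sp_eq_zero K L 𝔩 Δg εg hεg sp hsp n i y hy
  | succ m => exact sp_eq_succ K L 𝔩 Δg hΔg εg sp hsp n m i y hy

theorem io_eq (Δg : Ug K L →ₐ[K] TP K (Ug K L) 2) (hΔg : IsUECoproduct K L Δg)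
    (n m : ℕ) (i : Fin (n + 1))
    (ιf : TP K (Ug K L) (m + 1) →ₗ[K] TP K (Ug K L) (n + m + 1))
    (hιf : IsIotaMap K L 𝔩 Δg m ((i : ℕ) + 1) (n + m + 1) ιf)
    (y : TP K (Ug K L) (m + 1)) (hy : y ∈ lastSub K L 𝔩 m) :
    ιf y = SM K L m (n + m) (ioF i m) y := by
  refine lastSub_ind K L 𝔩 m ιf (SM K L m (n + m) (ioF i m)).toLinearMap ?_ y hy
  intro x b
  have hi := i.isLt
  obtain ⟨CZ, Z, hZ⟩ := exists_pres K L (n + m + 1 - ((i : ℕ) + 1) - m)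
    (DpowG K (Ug K L) Δg.toLinearMap (n + m + 1 - ((i : ℕ) + 1) - m) (inclUE K L 𝔩 b))
  refine (hιf x b CZ Z hZ).trans ?_
  have hq : n + m + 1 - ((i : ℕ) + 1) - m = n - i := by omega
  rw [AlgHom.toLinearMap_apply, chain_eq K L m _ _ (ext1_apply K L _), pN_map]
  set X := ext1 K L (Fin.snoc x (inclUE K L 𝔩 b) : Fin (m + 1) → Ug K L) with hX
  have e2 : n + m + 1 = (i : ℕ) + (m + ((n + m + 1 - ((i : ℕ) + 1) - m) + 1)) := by omega
  have q1 : pN (fun t => SM K L m (n + m) (ioF i m) (slA K L m t (X t))) m =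
      pN (fun t => slA K L (n + m) (i + t) (X t)) m := by
    refine pN_congr _ _ _ fun t ht => ?_
    refine SM_single K L _ _ _ t _ (by omega) (by omega) ?_ _
    intro r hr; unfold ioF; split_ifs <;> omega
  have q2 : X m = inclUE K L 𝔩 b := ext1_snoc_last K L x _
  have q3 : SM K L m (n + m) (ioF i m) (slA K L m m (X m)) =
      ∑ c, pN (fun t => slA K L (n + m) (i + m + t) (ext1 K L (Z c) t)) ((n + m + 1 - ((i : ℕ) + 1) - m) + 1) := by
    rw [SM_block K L Δg hΔg m (n + m) (i + m) ((n + m + 1 - ((i : ℕ) + 1) - m)) _ m (by omega) (by omega), q2, ← hZ, map_sum]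
    · refine Finset.sum_congr rfl fun c _ => ?_
      exact em_chain K L (i + m) ((n + m + 1 - ((i : ℕ) + 1) - m)) _ (by omega) _
    · intro r hr; unfold ioF; split_ifs <;> omega
  rw [pN, q1, q3, Finset.mul_sum]
  refine Finset.sum_congr rfl fun c _ => ?_
  rw [chain_eq K L (n + m) _ _ (ext1_apply K L _)]
  rw [pN_split _ _ _ _ _ e2, pN_one, one_mul]
  · congr 1
    · refine pN_congr _ _ _ fun t ht => ?_
      rw [ext1_lt K L _ _ (by omega), hX, ext1_snoc_lt K L _ _ _ (by omega)]
      simp [ht]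
    · refine pN_congr _ _ _ fun t ht => ?_
      rw [ext1_lt K L _ _ (by omega), ext1_lt K L _ _ ht]
      dsimp only
      rw [dif_neg (by omega), dif_neg (by omega), add_assoc (i : ℕ) m t]
      congr 3
      omega
  · intro t ht
    rw [ext1_lt K L _ _ (by omega)]
    simp [ht]

/-- the subalgebra `U(𝔤)^{⊗n} ⊗ U(𝔩)` -/
def LS (n : ℕ) : Subalgebra K (TP K (Ug K L) (n + 1)) :=
  Algebra.adjoin K
    ({z | ∃ t < n, ∃ x : L, z = slA K L n t (UniversalEnvelopingAlgebra.ι K x)} ∪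
      {z | ∃ l : 𝔩, z = slA K L n n (UniversalEnvelopingAlgebra.ι K (l : L))})

theorem LS_lt (n t : ℕ) (ht : t < n) (x : L) :
    slA K L n t (UniversalEnvelopingAlgebra.ι K x) ∈ LS K L 𝔩 n :=
  Algebra.subset_adjoin (Or.inl ⟨t, ht, x, rfl⟩)

theorem LS_last (n : ℕ) (l : 𝔩) :
    slA K L n n (UniversalEnvelopingAlgebra.ι K (l : L)) ∈ LS K L 𝔩 n :=
  Algebra.subset_adjoin (Or.inr ⟨l, rfl⟩)

theorem LS_le (n : ℕ) (S : Subalgebra K (TP K (Ug K L) (n + 1)))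
    (h1 : ∀ t < n, ∀ x : L, slA K L n t (UniversalEnvelopingAlgebra.ι K x) ∈ S)
    (h2 : ∀ l : 𝔩, slA K L n n (UniversalEnvelopingAlgebra.ι K (l : L)) ∈ S) :
    LS K L 𝔩 n ≤ S := by
  rw [LS, Algebra.adjoin_le_iff]
  rintro _ (⟨t, ht, x, rfl⟩ | ⟨l, rfl⟩)
  · exact h1 t ht x
  · exact h2 l

theorem incl_ι (l : 𝔩) : inclUE K L 𝔩 (UniversalEnvelopingAlgebra.ι K l) =
    UniversalEnvelopingAlgebra.ι K (l : L) := by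
  simp [inclUE]

theorem lastSub_mul (n : ℕ) (y z : TP K (Ug K L) (n + 1)) (hy : y ∈ lastSub K L 𝔩 n)
    (hz : z ∈ lastSub K L 𝔩 n) : y * z ∈ lastSub K L 𝔩 n := by
  have h := Submodule.mul_mem_mul hy hz
  rw [lastSub, Submodule.span_mul_span] at h
  refine Submodule.span_mono ?_ h
  rintro _ ⟨_, ⟨x, b, rfl⟩, _, ⟨x', b', rfl⟩, rfl⟩
  refine ⟨fun t => x t * x' t, b * b', ?_⟩
  dsimp only
  rw [chain_eq K L n _ _ (ext1_apply K L _), chain_eq K L n _ _ (ext1_apply K L _),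
    chain_eq K L n _ _ (ext1_apply K L _), pN_mul]
  · refine pN_congr _ _ _ fun t ht => ?_
    rw [← map_mul]
    congr 1
    by_cases h : t = n
    · subst h
      rw [ext1_snoc_last, ext1_snoc_last, ext1_snoc_last, map_mul]
    · rw [ext1_snoc_lt K L _ _ _ (by omega), ext1_snoc_lt K L _ _ _ (by omega),
        ext1_snoc_lt K L _ _ _ (by omega)]
  · intro s hs t ht hst
    exact slA_commute K L n s t (by omega) (by omega) hst _ _

theorem lastSub_slot (n t : ℕ) (ht : t ≤ n) (x : Ug K L) (b : Ul K L 𝔩)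
    (h : t = n → x = inclUE K L 𝔩 b) : slA K L n t x ∈ lastSub K L 𝔩 n := by
  refine Submodule.subset_span ⟨fun s => if (s : ℕ) = t then x else 1, if t = n then b else 1, ?_⟩
  rw [chain_eq K L n _ _ (ext1_apply K L _), pN_single _ _ t (by omega)]
  · congr 1
    by_cases h1 : t = n
    · subst h1
      rw [ext1_snoc_last, if_pos rfl]; exact h rfl
    · rw [ext1_snoc_lt K L _ _ _ (by omega)]
      simp
  · intro s hs hst
    have : ext1 K L (Fin.snoc (fun s : Fin n => if (s : ℕ) = t then x else 1)
      (inclUE K L 𝔩 (if t = n then b else 1)) : Fin (n + 1) → Ug K L) s = 1 := by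
      by_cases h1 : s = n
      · subst h1
        rw [ext1_snoc_last, if_neg (by omega), map_one]
      · rw [ext1_snoc_lt K L _ _ _ (by omega)]
        simp [hst]
    rw [this, map_one]

theorem lastSub_one (n : ℕ) : (1 : TP K (Ug K L) (n + 1)) ∈ lastSub K L 𝔩 n := by
  have := lastSub_slot K L 𝔩 n n le_rfl 1 1 (by intro _; rw [map_one])
  rwa [map_one] at this

theorem mem_LS (n : ℕ) (y : TP K (Ug K L) (n + 1)) : y ∈ LS K L 𝔩 n ↔ y ∈ lastSub K L 𝔩 n := by
  constructor
  · intro hy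
    refine LS_le K L 𝔩 n ((lastSub K L 𝔩 n).toSubalgebra (lastSub_one K L 𝔩 n)
      (lastSub_mul K L 𝔩 n)) ?_ ?_ hy
    · intro t ht x
      exact lastSub_slot K L 𝔩 n t (by omega) _ 1 (by intro; omega)
    · intro l
      exact lastSub_slot K L 𝔩 n n le_rfl _ (UniversalEnvelopingAlgebra.ι K l)
        (fun _ => (incl_ι K L 𝔩 l).symm)
  · intro hy
    have : lastSub K L 𝔩 n ≤ Subalgebra.toSubmodule (LS K L 𝔩 n) := by
      rw [lastSub, Submodule.span_le]
      rintro _ ⟨x, b, rfl⟩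
      rw [chain_eq K L n _ _ (ext1_apply K L _), pN]
      refine (LS K L 𝔩 n).mul_mem ?_ ?_
      · have : ∀ k ≤ n, pN (fun t => slA K L n t (ext1 K L
            (Fin.snoc x (inclUE K L 𝔩 b) : Fin (n + 1) → Ug K L) t)) k ∈ LS K L 𝔩 n := by
          intro k hk
          induction k with
          | zero => exact (LS K L 𝔩 n).one_mem
          | succ k ih =>
            refine (LS K L 𝔩 n).mul_mem (ih (by omega)) ?_
            exact ug_mem K L ((LS K L 𝔩 n).comap (slA K L n k))
              (fun x => LS_lt K L 𝔩 n k (by omega) x) _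
        exact this n le_rfl
      · rw [ext1_snoc_last]
        exact ug_mem K 𝔩 ((LS K L 𝔩 n).comap ((slA K L n n).comp (inclUE K L 𝔩)))
          (fun l => by
            simp only [Subalgebra.mem_comap, AlgHom.comp_apply]
            rw [incl_ι]
            exact LS_last K L 𝔩 n l) b
    exact this hy

theorem SM_LS (a b : ℕ) (ψ : ℕ → ℕ) (hψ : a ≤ ψ b) (y) (hy : y ∈ LS K L 𝔩 a) :
    SM K L a b ψ y ∈ LS K L 𝔩 b := by
  refine LS_le K L 𝔩 a ((LS K L 𝔩 b).comap (SM K L a b ψ)) ?_ ?_ hy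
  · intro t ht x
    simp only [Subalgebra.mem_comap]
    rw [SM_ι K L _ _ _ _ (by omega)]
    refine Subalgebra.sum_mem _ fun s hs => ?_
    simp only [Finset.mem_filter, Finset.mem_range] at hs
    exact LS_lt K L 𝔩 b s (lt_of_le_of_ne (by omega) (by rintro rfl; omega)) x
  · intro l
    simp only [Subalgebra.mem_comap]
    rw [SM_ι K L _ _ _ _ (by omega)]
    refine Subalgebra.sum_mem _ fun s hs => ?_
    simp only [Finset.mem_filter, Finset.mem_range] at hs
    by_cases h : s = b
    · subst h; exact LS_last K L 𝔩 s l
    · exact LS_lt K L 𝔩 b s (by omega) l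

theorem SM_comp2 (a b b' c : ℕ) (ψ χ ψ' χ' : ℕ → ℕ)
    (h : ∀ r ≤ c, ∀ t ≤ a, (χ r ≤ b ∧ ψ (χ r) = t) ↔ (χ' r ≤ b' ∧ ψ' (χ' r) = t)) (y) :
    SM K L b c χ (SM K L a b ψ y) = SM K L b' c χ' (SM K L a b' ψ' y) := by
  rw [SM_comp K L a b c ψ χ (fun r => if χ r ≤ b then ψ (χ r) else a + 1),
    SM_comp K L a b' c ψ' χ' (fun r => if χ r ≤ b then ψ (χ r) else a + 1)]
  · intro r hr t ht
    rw [← h r hr t ht]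
    split_ifs with h1
    · exact ⟨fun h => ⟨h1, h⟩, fun h => h.2⟩
    · exact ⟨fun h => by omega, fun h => absurd h.1 h1⟩
  · intro r hr t ht
    split_ifs with h1
    · exact ⟨fun h => ⟨h1, h⟩, fun h => h.2⟩
    · exact ⟨fun h => by omega, fun h => absurd h.1 h1⟩

theorem D_sum (Δg : Ug K L →ₐ[K] TP K (Ug K L) 2) (hΔg : IsUECoproduct K L Δg) (n : ℕ) (x : L) :
    DpowG K (Ug K L) Δg.toLinearMap n (UniversalEnvelopingAlgebra.ι K x) =
      ∑ s ∈ Finset.range (n + 1), slA K L n s (UniversalEnvelopingAlgebra.ι K x) := by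
  rw [DpowG_eq K L Δg hΔg, SM_ι K L _ _ _ _ le_rfl]
  simp

theorem SM_D (Δg : Ug K L →ₐ[K] TP K (Ug K L) 2) (hΔg : IsUECoproduct K L Δg) (a b : ℕ)
    (ψ : ℕ → ℕ) (x : L) :
    SM K L a b ψ (DpowG K (Ug K L) Δg.toLinearMap a (UniversalEnvelopingAlgebra.ι K x)) =
      ∑ s ∈ (Finset.range (b + 1)).filter (fun s => ψ s ≤ a),
        slA K L b s (UniversalEnvelopingAlgebra.ι K x) := by
  rw [DpowG_eq K L Δg hΔg, SM_comp K L 0 a b _ ψ (fun r => if ψ r ≤ a then 0 else 1),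
    SM_ι K L _ _ _ _ le_rfl]
  · refine Finset.sum_congr ?_ fun _ _ => rfl
    ext r
    simp
  · intro r hr t ht
    split_ifs <;> omega

theorem SM_comm_slot (a b : ℕ) (ψ : ℕ → ℕ) (s : ℕ) (hs : s ≤ b) (h : a < ψ s) (g : Ug K L) (y) :
    Commute (slA K L b s g) (SM K L a b ψ y) := by
  have := tp_mem K L a ((Subalgebra.centralizer K {slA K L b s g}).comap (SM K L a b ψ)) (by
    intro t ht x
    simp only [Subalgebra.mem_comap, Subalgebra.mem_centralizer_iff,
      Set.mem_singleton_iff, forall_eq]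
    rw [SM_ι K L _ _ _ _ ht]
    refine (Commute.sum_right _ _ _ fun r hr => ?_).eq
    simp only [Finset.mem_filter, Finset.mem_range] at hr
    exact slA_commute K L b s r hs (by omega) (by rintro rfl; omega) _ _) y
  simp only [Subalgebra.mem_comap, Subalgebra.mem_centralizer_iff,
      Set.mem_singleton_iff, forall_eq] at this
  exact this

theorem tail_comm (Δg : Ug K L →ₐ[K] TP K (Ug K L) 2) (hΔg : IsUECoproduct K L Δg) (a b : ℕ)
    (ψ : ℕ → ℕ) (p : ℕ → Prop) [DecidablePred p] (hp : ∀ s ≤ b, ψ s ≤ a → p s) (x : L) (y)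
    (hy : Commute (DpowG K (Ug K L) Δg.toLinearMap a (UniversalEnvelopingAlgebra.ι K x)) y) :
    Commute (∑ s ∈ (Finset.range (b + 1)).filter p,
      slA K L b s (UniversalEnvelopingAlgebra.ι K x)) (SM K L a b ψ y) := by
  rw [← Finset.sum_filter_add_sum_filter_not _ (fun s => ψ s ≤ a)]
  refine Commute.add_left ?_ ?_
  · have h := hy.map (SM K L a b ψ)
    rw [SM_D K L Δg hΔg] at h
    convert h using 2
    ext r
    simp only [Finset.mem_filter, Finset.mem_range]
    constructor
    · rintro ⟨⟨h1, h2⟩, h3⟩; exact ⟨h1, h3⟩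
    · rintro ⟨h1, h3⟩; exact ⟨⟨h1, hp r (by omega) h3⟩, h3⟩
  · refine Commute.sum_left _ _ _ fun s hs => ?_
    simp only [Finset.mem_filter, Finset.mem_range] at hs
    exact SM_comm_slot K L a b ψ s (by omega) (by omega) _ _

theorem par_comm (Δg : Ug K L →ₐ[K] TP K (Ug K L) 2) (hΔg : IsUECoproduct K L Δg)
    (i q k l N : ℕ) (hik : i + q ≤ k) (y) (hy : y ∈ LS K L 𝔩 q) (z)
    (hz : ∀ x : 𝔩,
      Commute (DpowG K (Ug K L) Δg.toLinearMap l (UniversalEnvelopingAlgebra.ι K (x : L))) z) :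
    Commute (SM K L q N (ioF i q) y) (SM K L l N (ioF k l) z) := by
  have := LS_le K L 𝔩 q
    ((Subalgebra.centralizer K {SM K L l N (ioF k l) z}).comap (SM K L q N (ioF i q))) (by
      intro t ht x
      simp only [Subalgebra.mem_comap, Subalgebra.mem_centralizer_iff,
        Set.mem_singleton_iff, forall_eq]
      rw [SM_ι K L _ _ _ _ ht.le]
      refine (Commute.sum_left _ _ _ fun r hr => ?_).symm.eq
      simp only [Finset.mem_filter, Finset.mem_range] at hr
      refine SM_comm_slot K L _ _ _ r (by omega) ?_ _ _
      have h2 := hr.2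
      unfold ioF at h2 ⊢
      split_ifs at h2 ⊢ <;> omega) (by
      intro x
      simp only [Subalgebra.mem_comap, Subalgebra.mem_centralizer_iff,
        Set.mem_singleton_iff, forall_eq]
      rw [SM_ι K L _ _ _ _ le_rfl]
      refine (tail_comm K L Δg hΔg _ _ _ _ ?_ _ _ (hz x)).symm.eq
      intro s hs h2
      unfold ioF at h2 ⊢
      split_ifs at h2 ⊢ <;> omega) hy
  simp only [Subalgebra.mem_comap, Subalgebra.mem_centralizer_iff,
      Set.mem_singleton_iff, forall_eq] at this
  exact (show Commute _ _ from this).symm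

/-- slot maps on power series -/
def PM (a b : ℕ) (ψ : ℕ → ℕ) :
    PowerSeries (TP K (Ug K L) (a + 1)) →+* PowerSeries (TP K (Ug K L) (b + 1)) :=
  PowerSeries.map (SM K L a b ψ).toRingHom

theorem PM_coeff (a b : ℕ) (ψ : ℕ → ℕ) (A) (d : ℕ) :
    PowerSeries.coeff d (PM K L a b ψ A) = SM K L a b ψ (PowerSeries.coeff d A) := by
  simp [PM]

theorem PM_comp2 (a b b' c : ℕ) (ψ χ ψ' χ' : ℕ → ℕ) (A)
    (h : ∀ r ≤ c, ∀ t ≤ a, (χ r ≤ b ∧ ψ (χ r) = t) ↔ (χ' r ≤ b' ∧ ψ' (χ' r) = t)) :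
    PM K L b c χ (PM K L a b ψ A) = PM K L b' c χ' (PM K L a b' ψ' A) := by
  ext d
  simp only [PM_coeff]
  exact SM_comp2 K L a b b' c ψ χ ψ' χ' h _

theorem PM_comp (a b c : ℕ) (ψ χ ρ : ℕ → ℕ) (A)
    (h : ∀ r ≤ c, ∀ t ≤ a, ρ r = t ↔ χ r ≤ b ∧ ψ (χ r) = t) :
    PM K L b c χ (PM K L a b ψ A) = PM K L a c ρ A := by
  ext d
  simp only [PM_coeff]
  exact SM_comp K L a b c ψ χ ρ h _

theorem PM_id (a : ℕ) (ψ : ℕ → ℕ) (h : ∀ r ≤ a, ψ r = r) (A) : PM K L a a ψ A = A := by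
  ext d
  rw [PM_coeff]
  exact SM_id K L a ψ h _

theorem psCast_mul {a b : ℕ} (h : a = b) (A B : PowerSeries (TP K (Ug K L) a)) :
    psCast K L h (A * B) = psCast K L h A * psCast K L h B := by
  subst h; rfl

theorem psCast_PM {a b c : ℕ} (h : b + 1 = c + 1) (ψ : ℕ → ℕ) (A) :
    psCast K L h (PM K L a b ψ A) = PM K L a c ψ A := by
  obtain rfl : b = c := by omega
  rfl

theorem psCast_eq {a b : ℕ} (h : a + 1 = b + 1) (ψ : ℕ → ℕ) (hψ : ∀ r ≤ a, ψ r = r) (A) :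
    psCast K L h A = PM K L a b ψ A := by
  obtain rfl : a = b := by omega
  rw [PM_id K L a ψ hψ]
  rfl

theorem ps_comm {T : Type u} [Ring T] (A B : PowerSeries T)
    (h : ∀ d e, Commute (PowerSeries.coeff d A) (PowerSeries.coeff e B)) : A * B = B * A := by
  ext d
  rw [PowerSeries.coeff_mul, PowerSeries.coeff_mul, ← Finset.Nat.sum_antidiagonal_swap]
  refine Finset.sum_congr rfl fun p _ => ?_
  exact (h _ _).eq

/-- all coefficients lie in `U(𝔤)^{⊗n} ⊗ U(𝔩)` -/
def PL (n : ℕ) (A : PowerSeries (TP K (Ug K L) (n + 1))) : Prop :=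
  ∀ d : ℕ, PowerSeries.coeff d A ∈ LS K L 𝔩 n

theorem PL_mul (n : ℕ) (A B) (hA : PL K L 𝔩 n A) (hB : PL K L 𝔩 n B) : PL K L 𝔩 n (A * B) := by
  intro d
  rw [PowerSeries.coeff_mul]
  exact Subalgebra.sum_mem _ fun p _ => (LS K L 𝔩 n).mul_mem (hA _) (hB _)

theorem PL_one (n : ℕ) : PL K L 𝔩 n 1 := by
  intro d
  rw [PowerSeries.coeff_one]
  split_ifs
  · exact (LS K L 𝔩 n).one_mem
  · exact (LS K L 𝔩 n).zero_mem

theorem PL_PM (a b : ℕ) (ψ : ℕ → ℕ) (hψ : a ≤ ψ b) (A) (hA : PL K L 𝔩 a A) :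
    PL K L 𝔩 b (PM K L a b ψ A) := by
  intro d
  rw [PM_coeff]
  exact SM_LS K L 𝔩 a b ψ hψ _ (hA d)

theorem Memb_PL (Δg : Ug K L →ₐ[K] TP K (Ug K L) 2) (n : ℕ) (A) (h : Memb K L 𝔩 Δg n A) :
    PL K L 𝔩 n A := fun d => (mem_LS K L 𝔩 n _).2 (h.1 d)

theorem comm_iff {T : Type u} [Ring T] (D : T) (A : PowerSeries T) :
    PowerSeries.C D * A = A * PowerSeries.C D ↔ ∀ d, Commute D (PowerSeries.coeff d A) := by
  rw [PowerSeries.ext_iff]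
  refine forall_congr' fun d => ?_
  rw [PowerSeries.coeff_C_mul, PowerSeries.coeff_mul_C]
  rfl

theorem Memb_comm (Δg : Ug K L →ₐ[K] TP K (Ug K L) 2) (n : ℕ) (A) (h : Memb K L 𝔩 Δg n A)
    (l : 𝔩) (d : ℕ) :
    Commute (DpowG K (Ug K L) Δg.toLinearMap n (UniversalEnvelopingAlgebra.ι K (l : L)))
      (PowerSeries.coeff d A) := (comm_iff _ _).1 (h.2 l) d

theorem Memb_of (Δg : Ug K L →ₐ[K] TP K (Ug K L) 2) (n : ℕ) (A) (h : PL K L 𝔩 n A)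
    (h2 : ∀ (l : 𝔩) (d : ℕ),
    Commute (DpowG K (Ug K L) Δg.toLinearMap n (UniversalEnvelopingAlgebra.ι K (l : L)))
      (PowerSeries.coeff d A)) : Memb K L 𝔩 Δg n A :=
  ⟨fun d => (mem_LS K L 𝔩 n _).1 (h d), fun l => (comm_iff _ _).2 (h2 l)⟩

/-- the composition -/
def CM (n m i : ℕ) (A : PowerSeries (TP K (Ug K L) (n + 1 + 1)))
    (B : PowerSeries (TP K (Ug K L) (m + 1))) : PowerSeries (TP K (Ug K L) (n + m + 1)) :=
  PM K L (n + 1) (n + m) (spF i m) A * PM K L m (n + m) (ioF i m) B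

theorem CM_PL (n m i : ℕ) (hi : i ≤ n) (A B) (hA : PL K L 𝔩 (n + 1) A) (hB : PL K L 𝔩 m B) :
    PL K L 𝔩 (n + m) (CM K L n m i A B) := by
  refine PL_mul K L 𝔩 _ _ _ (PL_PM K L 𝔩 _ _ _ ?_ _ hA) (PL_PM K L 𝔩 _ _ _ ?_ _ hB)
  · unfold spF; split_ifs <;> omega
  · unfold ioF; split_ifs <;> omega

theorem CM_Memb (Δg : Ug K L →ₐ[K] TP K (Ug K L) 2) (hΔg : IsUECoproduct K L Δg)
    (n m i : ℕ) (hi : i ≤ n) (A B) (hA : Memb K L 𝔩 Δg (n + 1) A) (hB : Memb K L 𝔩 Δg m B) :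
    Memb K L 𝔩 Δg (n + m) (CM K L n m i A B) := by
  refine Memb_of K L 𝔩 Δg _ _ (CM_PL K L 𝔩 n m i hi A B (Memb_PL K L 𝔩 Δg _ _ hA)
    (Memb_PL K L 𝔩 Δg _ _ hB)) ?_
  intro l d
  rw [CM, PowerSeries.coeff_mul]
  refine Commute.sum_right _ _ _ fun p _ => Commute.mul_right ?_ ?_
  · rw [PM_coeff]
    have h := (Memb_comm K L 𝔩 Δg _ _ hA l p.1).map (SM K L (n + 1) (n + m) (spF i m))
    rw [SM_D K L Δg hΔg, Finset.filter_true_of_mem, ← D_sum K L Δg hΔg] at h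
    · exact h
    · intro x hx
      simp only [Finset.mem_range] at hx
      unfold spF; split_ifs <;> omega
  · rw [PM_coeff]
    have h := tail_comm K L Δg hΔg m (n + m) (ioF i m) (fun _ => True) (fun _ _ _ => trivial) l _
      (Memb_comm K L 𝔩 Δg _ _ hB l p.2)
    rw [Finset.filter_true, ← D_sum K L Δg hΔg] at h
    exact h

theorem CM_seq (n m l i j : ℕ) (hi : i ≤ n) (hj : j ≤ m) (A B C)
    (h : n + (m + l) + 1 = n + m + l + 1) :
    CM K L (n + m) l (i + j) (CM K L n (m + 1) i A B) C =
      psCast K L h (CM K L n (m + l) i A (CM K L m l j B C)) := by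
  unfold CM
  rw [psCast_mul, psCast_PM, psCast_PM, map_mul, map_mul]
  have hA : PM K L (n + m + 1) (n + m + l) (spF (i + j) l)
      (PM K L (n + 1) (n + m + 1) (spF i (m + 1)) A) =
      PM K L (n + 1) (n + m + l) (spF i (m + l)) A := by
    refine PM_comp K L _ _ _ _ _ _ _ ?_
    intro r hr t ht
    unfold spF
    split_ifs <;> omega
  have hB : PM K L (n + m + 1) (n + m + l) (spF (i + j) l)
      (PM K L (m + 1) (n + m + 1) (ioF i (m + 1)) B) =
      PM K L (m + l) (n + m + l) (ioF i (m + l)) (PM K L (m + 1) (m + l) (spF j l) B) := by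
    refine PM_comp2 K L _ _ _ _ _ _ _ _ _ ?_
    intro r hr t ht
    unfold spF ioF
    split_ifs <;> omega
  have hC : PM K L (m + l) (n + m + l) (ioF i (m + l)) (PM K L l (m + l) (ioF j l) C) =
      PM K L l (n + m + l) (ioF (i + j) l) C := by
    refine PM_comp K L _ _ _ _ _ _ _ ?_
    intro r hr t ht
    unfold ioF
    split_ifs <;> omega
  rw [hC, ← hB, ← mul_assoc, ← hA]
  rfl

theorem CM_par (Δg : Ug K L →ₐ[K] TP K (Ug K L) 2) (hΔg : IsUECoproduct K L Δg)
    (n m l i k : ℕ) (hik : i < k) (hk : k ≤ n + 1) (A B C)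
    (hB : PL K L 𝔩 (m + 1) B) (hC : Memb K L 𝔩 Δg l C)
    (h : n + l + (m + 1) + 1 = n + 1 + m + l + 1) (h' : n + 1 + l + 1 = n + l + 1 + 1) :
    CM K L (n + 1 + m) l (k + m) (CM K L (n + 1) (m + 1) i A B) C =
      psCast K L h (CM K L (n + l) (m + 1) i (psCast K L h' (CM K L (n + 1) l k A C)) B) := by
  unfold CM
  rw [psCast_mul, psCast_PM, psCast_PM, psCast_mul, psCast_PM, psCast_PM, map_mul, map_mul]
  have hA : PM K L (n + 1 + m + 1) (n + 1 + m + l) (spF (k + m) l)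
      (PM K L (n + 1 + 1) (n + 1 + m + 1) (spF i (m + 1)) A) =
      PM K L (n + l + 1) (n + 1 + m + l) (spF i (m + 1)) 
        (PM K L (n + 1 + 1) (n + l + 1) (spF k l) A) := by
    refine PM_comp2 K L _ _ _ _ _ _ _ _ _ ?_
    intro r hr t ht
    unfold spF
    split_ifs <;> omega
  have hBB : PM K L (n + 1 + m + 1) (n + 1 + m + l) (spF (k + m) l)
      (PM K L (m + 1) (n + 1 + m + 1) (ioF i (m + 1)) B) =
      PM K L (m + 1) (n + 1 + m + l) (ioF i (m + 1)) B := by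
    refine PM_comp K L _ _ _ _ _ _ _ ?_
    intro r hr t ht
    unfold spF ioF
    split_ifs <;> omega
  have hCC : PM K L (n + l + 1) (n + 1 + m + l) (spF i (m + 1))
      (PM K L l (n + l + 1) (ioF k l) C) =
      PM K L l (n + 1 + m + l) (ioF (k + m) l) C := by
    refine PM_comp K L _ _ _ _ _ _ _ ?_
    intro r hr t ht
    unfold spF ioF
    split_ifs <;> omega
  have hcomm : PM K L (m + 1) (n + 1 + m + l) (ioF i (m + 1)) B *
      PM K L l (n + 1 + m + l) (ioF (k + m) l) C =
      PM K L l (n + 1 + m + l) (ioF (k + m) l) C *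
      PM K L (m + 1) (n + 1 + m + l) (ioF i (m + 1)) B := by
    refine ps_comm _ _ fun d e => ?_
    rw [PM_coeff, PM_coeff]
    exact par_comm K L 𝔩 Δg hΔg _ _ _ _ _ (by omega) _ (hB d) _
      (fun x => Memb_comm K L 𝔩 Δg _ _ hC x e)
  rw [hCC]
  refine Eq.trans ?_ (mul_assoc _ _ _).symm
  rw [← hcomm, ← hA, ← hBB]
  exact mul_assoc _ _ _

end OperadProof

/-- **The non-symmetric operad `P_{(𝔤,𝔩)}` of a Lie algebra pair.**
Let `(𝔤, 𝔩)` be a Lie algebra pair over `K` and set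
`P(n) := (U(𝔤)^{⊗n} ⊗ U(𝔩)⟦ℏ⟧)^𝔩`.  The partial compositions
`A ∘_i B := ((id^{⊗(i−1)} ⊗ Δ^{m−1} ⊗ id^{⊗(n−i)} ⊗ id)(A)) · ι_{i,n+m}(B)` (with `ε`
in place of `Δ^{−1}` when `m = 0`): (i) preserve `𝔩`-invariance, i.e. send
`P(n+1) × P(m)` to `P(n+m)`; and (ii) together with the identity `1 ⊗ 1 ∈ P(1)` make
`(P(n))ₙ` a non-symmetric operad: the sequential, parallel and unitality axioms hold. -/
theorem liePair_operad
    (K : Type u) [Field K] [CharZero K]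
    (L : Type u) [LieRing L] [LieAlgebra K L] [Module.Finite K L]
    (𝔩 : LieSubalgebra K L)
    (Δg : Ug K L →ₐ[K] TP K (Ug K L) 2) (hΔg : IsUECoproduct K L Δg)
    (εg : Ug K L →ₐ[K] K) (hεg : IsUECounit K L εg)
    (sp : ∀ (n m : ℕ), Fin (n + 1) →
      (TP K (Ug K L) (n + 2) →ₗ[K] TP K (Ug K L) (n + m + 1)))
    (hsp : IsSpliceFamily K L 𝔩 Δg εg sp)
    (ιf : ∀ (n m : ℕ), Fin (n + 1) →
      (TP K (Ug K L) (m + 1) →ₗ[K] TP K (Ug K L) (n + m + 1)))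
    (hιf : ∀ (n m : ℕ) (i : Fin (n + 1)),
      IsIotaMap K L 𝔩 Δg m ((i : ℕ) + 1) (n + m + 1) (ιf n m i)) :
    -- the partial compositions of `P_{(𝔤,𝔩)}`
    let cmp : ∀ (n m : ℕ), Fin (n + 1) →
        PowerSeries (TP K (Ug K L) (n + 2)) → PowerSeries (TP K (Ug K L) (m + 1)) →
        PowerSeries (TP K (Ug K L) (n + m + 1)) :=
      fun n m i A B =>
        PowerSeries.mk (fun d => sp n m i ((PowerSeries.coeff d) A)) *
          PowerSeries.mk (fun d => ιf n m i ((PowerSeries.coeff d) B))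
    -- (i) `𝔩`-invariance is preserved
    (∀ (n m : ℕ) (i : Fin (n + 1)) (A : PowerSeries (TP K (Ug K L) (n + 2)))
        (B : PowerSeries (TP K (Ug K L) (m + 1))),
      Memb K L 𝔩 Δg (n + 1) A → Memb K L 𝔩 Δg m B →
      Memb K L 𝔩 Δg (n + m) (cmp n m i A B)) ∧
    -- the identity `1 ⊗ 1 ∈ P(1)`
    Memb K L 𝔩 Δg 1 1 ∧
    -- left unitality
    (∀ (m : ℕ) (B : PowerSeries (TP K (Ug K L) (m + 1))), Memb K L 𝔩 Δg m B →
      cmp 0 m ⟨0, Nat.zero_lt_succ 0⟩ 1 B = psCast K L (by omega) B) ∧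
    -- right unitality
    (∀ (n : ℕ) (i : Fin (n + 1)) (A : PowerSeries (TP K (Ug K L) (n + 2))),
      Memb K L 𝔩 Δg (n + 1) A → cmp n 1 i A 1 = A) ∧
    -- the sequential composition axiom
    (∀ (n m l : ℕ) (i : Fin (n + 1)) (j : Fin (m + 1))
        (A : PowerSeries (TP K (Ug K L) (n + 2)))
        (B : PowerSeries (TP K (Ug K L) (m + 2)))
        (Cc : PowerSeries (TP K (Ug K L) (l + 1))),
      Memb K L 𝔩 Δg (n + 1) A → Memb K L 𝔩 Δg (m + 1) B → Memb K L 𝔩 Δg l Cc →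
      cmp (n + m) l ⟨(i : ℕ) + (j : ℕ), by have := i.isLt; have := j.isLt; omega⟩
          (cmp n (m + 1) i A B) Cc =
        psCast K L (by omega) (cmp n (m + l) i A (cmp m l j B Cc))) ∧
    -- the parallel composition axiom
    (∀ (n m l : ℕ) (i k : ℕ) (hik : i < k) (hk : k ≤ n + 1)
        (A : PowerSeries (TP K (Ug K L) (n + 3)))
        (B : PowerSeries (TP K (Ug K L) (m + 2)))
        (Cc : PowerSeries (TP K (Ug K L) (l + 1))),
      Memb K L 𝔩 Δg (n + 2) A → Memb K L 𝔩 Δg (m + 1) B → Memb K L 𝔩 Δg l Cc →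
      cmp (n + 1 + m) l ⟨k + m, by omega⟩ (cmp (n + 1) (m + 1) ⟨i, by omega⟩ A B) Cc =
        psCast K L (by omega)
          (cmp (n + l) (m + 1) ⟨i, by omega⟩
            (psCast K L (by omega) (cmp (n + 1) l ⟨k, by omega⟩ A Cc)) B)) := by
  intro cmp
  have hc : ∀ (n m : ℕ) (i : Fin (n + 1)) (A : PowerSeries (TP K (Ug K L) (n + 2)))
      (B : PowerSeries (TP K (Ug K L) (m + 1))), PL K L 𝔩 (n + 1) A → PL K L 𝔩 m B →
      cmp n m i A B = CM K L n m i A B := by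
    intro n m i A B hA hB
    have h1 : PowerSeries.mk (fun d => sp n m i ((PowerSeries.coeff d) A)) =
        PM K L (n + 1) (n + m) (spF i m) A := by
      ext d
      rw [PM_coeff, PowerSeries.coeff_mk]
      exact sp_eq K L 𝔩 Δg hΔg εg hεg sp hsp n m i _ ((mem_LS K L 𝔩 _ _).1 (hA d))
    have h2 : PowerSeries.mk (fun d => ιf n m i ((PowerSeries.coeff d) B)) =
        PM K L m (n + m) (ioF i m) B := by
      ext d
      rw [PM_coeff, PowerSeries.coeff_mk]
      exact io_eq K L 𝔩 Δg hΔg n m i _ (hιf n m i) _ ((mem_LS K L 𝔩 _ _).1 (hB d))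
    exact congrArg₂ (· * ·) h1 h2
  clear_value cmp
  refine ⟨?_, ?_, ?_, ?_, ?_, ?_⟩
  · intro n m i A B hA hB
    have := i.isLt
    rw [hc n m i A B (Memb_PL K L 𝔩 Δg _ _ hA) (Memb_PL K L 𝔩 Δg _ _ hB)]
    exact CM_Memb K L 𝔩 Δg hΔg n m i (by omega) A B hA hB
  · refine Memb_of K L 𝔩 Δg 1 1 (PL_one K L 𝔩 1) ?_
    intro l d
    rw [PowerSeries.coeff_one]
    split_ifs
    · exact Commute.one_right _
    · exact Commute.zero_right _
  · intro m B hB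
    rw [hc 0 m _ 1 B (PL_one K L 𝔩 1) (Memb_PL K L 𝔩 Δg _ _ hB), CM,
      psCast_eq K L _ (ioF 0 m), map_one, one_mul]
    intro r hr
    unfold ioF; split_ifs <;> omega
  · intro n i A hA
    have h1 : CM K L n 1 i A 1 = A := by
      rw [CM, map_one, mul_one]
      refine PM_id K L (n + 1) _ ?_ A
      intro r hr
      unfold spF; split_ifs <;> omega
    exact (hc n 1 i A 1 (Memb_PL K L 𝔩 Δg _ _ hA) (PL_one K L 𝔩 1)).trans h1
  · intro n m l i j A B Cc hA hB hC
    have hA' := Memb_PL K L 𝔩 Δg _ _ hA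
    have hB' := Memb_PL K L 𝔩 Δg _ _ hB
    have hC' := Memb_PL K L 𝔩 Δg _ _ hC
    have hi := i.isLt
    have hj := j.isLt
    rw [hc n (m + 1) i A B hA' hB', hc m l j B Cc hB' hC',
      hc n (m + l) i A _ hA' (CM_PL K L 𝔩 m l j (by omega) _ _ hB' hC')]
    refine (hc (n + m) l _ _ Cc (CM_PL K L 𝔩 n (m + 1) i (by omega) _ _ hA' hB') hC').trans ?_
    exact CM_seq K L n m l i j (by omega) (by omega) A B Cc _
  · intro n m l i k hik hk A B Cc hA hB hC
    have hA' := Memb_PL K L 𝔩 Δg _ _ hA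
    have hB' := Memb_PL K L 𝔩 Δg _ _ hB
    have hC' := Memb_PL K L 𝔩 Δg _ _ hC
    rw [hc (n + 1) (m + 1) _ A B hA' hB', hc (n + 1) l _ A Cc hA' hC']
    refine (hc (n + 1 + m) l _ _ Cc
      (CM_PL K L 𝔩 (n + 1) (m + 1) i (by omega) _ _ hA' hB') hC').trans ?_
    rw [hc (n + l) (m + 1) _ _ B ?_ hB']
    · exact CM_par K L 𝔩 Δg hΔg n m l i k hik hk A B Cc hB' hC _ _
    · have hP := CM_PL K L 𝔩 (n + 1) l k (by omega) A Cc hA' hC'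
      rw [psCast_eq K L _ (fun r => r) (fun _ _ => rfl)]
      exact PL_PM K L 𝔩 _ _ _ (by omega) _ hP
end
end
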